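/- arXiv:1701.03407 — 3 statements merged into one kernel-verified Lean document; each statement's English description precedes it below -/
import Mathlib

section
/- Let ρ be a positive finite measure on 𝕋, W : 𝕋 → [1,∞] measurable, β, M > 0, and A sufficiently large (depending on β, M). Assume ∫_𝕋 W^β dρ ≤ C < ∞ and that the Poisson extension satisfies (log min(W, e^A)) * P_{1-1/A} ≤ M·log W pointwise on 𝕋. Then for n ≥ A²β/(2M), e_n(ρ) ≤ sqrt(2C + ρ(𝕋)/2) · exp( −(β/(2M)) ∫_𝕋 log min(W, e^A) dm ). -/
open MeasureTheory ENNReal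

/-- `eN ρ n` : the distance in `L²(ρ)` from the constant `1` to the set of
polynomials of degree at most `n` vanishing at `0`. -/
noncomputable def eN (ρ : Measure ℂ) (n : ℕ) : ℝ :=
  sInf {r : ℝ | ∃ Q : Polynomial ℂ, Q.natDegree ≤ n ∧ Q.eval 0 = 0 ∧
    r = (∫ z, ‖(1 : ℂ) - Q.eval z‖ ^ 2 ∂ρ) ^ (1 / 2 : ℝ)}

/-- The Poisson kernel `P_r(θ) = (1 - r²)/(1 - 2r cos θ + r²)`. -/
noncomputable def poissonKer (r θ : ℝ) : ℝ :=
  (1 - r ^ 2) / (1 - 2 * r * Real.cos θ + r ^ 2)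

/-- `log W_A` on the circle, in the angular variable: `W_A = min(W, e^A)`. -/
noncomputable def logWA (W : ℂ → ℝ≥0∞) (A θ : ℝ) : ℝ :=
  Real.log (min (W (Complex.exp ((θ : ℂ) * Complex.I)))
    (ENNReal.ofReal (Real.exp A))).toReal

theorem norm_circleAverage_le_circleAverage_norm {E : Type*} [NormedAddCommGroup E]
    [NormedSpace ℝ E] (f : ℂ → E) (c : ℂ) (R : ℝ) :
    ‖Real.circleAverage f c R‖ ≤ Real.circleAverage (fun z ↦ ‖f z‖) c R := by
  rw [Real.circleAverage, Real.circleAverage, norm_smul, smul_eq_mul,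
    Real.norm_of_nonneg (inv_nonneg.2 Real.two_pi_pos.le)]
  exact mul_le_mul_of_nonneg_left
    (intervalIntegral.norm_integral_le_integral_norm Real.two_pi_pos.le)
    (inv_nonneg.2 Real.two_pi_pos.le)

theorem poissonKernel_zero_nonneg {w z : ℂ} (hw : w ∈ Metric.ball (0 : ℂ) 1)
    (hz : z ∈ Metric.sphere (0 : ℂ) 1) : 0 ≤ poissonKernel 0 w z := by
  rw [mem_ball_zero_iff] at hw
  rw [mem_sphere_zero_iff_norm] at hz
  rw [poissonKernel_def]
  simp only [sub_zero, hz]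
  have : ‖w‖ ^ 2 ≤ 1 := pow_le_one₀ (norm_nonneg _) hw.le
  apply div_nonneg <;> nlinarith [sq_nonneg ‖z - w‖]

theorem continuousOn_poissonKernel_zero {w : ℂ} (hw : w ∈ Metric.ball (0 : ℂ) 1) :
    ContinuousOn (poissonKernel 0 w) (Metric.sphere 0 1) := by
  have : ∀ z ∈ Metric.sphere (0 : ℂ) 1, ‖(z - 0) - (w - 0)‖ ^ 2 ≠ 0 := by
    intro z hz h
    rw [mem_ball_zero_iff] at hw
    rw [mem_sphere_zero_iff_norm] at hz
    have : z = w := by simpa [sub_eq_zero] using h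
    rw [this] at hz
    exact hw.ne hz
  unfold poissonKernel
  fun_prop (disch := assumption)

theorem DiffContOnCl.continuousOn_sphere {f : ℂ → ℂ} (hf : DiffContOnCl ℂ f (Metric.ball 0 1)) :
    ContinuousOn f (Metric.sphere 0 1) := by
  refine hf.2.mono ?_
  rw [closure_ball 0 one_ne_zero]
  exact Metric.sphere_subset_closedBall

theorem circleIntegrable_poissonKernel_smul {E : Type*} [NormedAddCommGroup E] [NormedSpace ℝ E]
    {f : ℂ → E} {w : ℂ} (hw : w ∈ Metric.ball (0 : ℂ) 1)
    (hf : ContinuousOn f (Metric.sphere 0 1)) :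
    CircleIntegrable (fun z ↦ poissonKernel 0 w z • f z) 0 1 :=
  ((continuousOn_poissonKernel_zero hw).smul hf).circleIntegrable zero_le_one

theorem circleAverage_poissonKernel_smul_conj {f : ℂ → ℂ} {w : ℂ}
    (hf : DiffContOnCl ℂ f (Metric.ball 0 1)) (hw : w ∈ Metric.ball (0 : ℂ) 1) :
    Real.circleAverage (fun z ↦ poissonKernel 0 w z • starRingEnd ℂ (f z)) 0 1
      = starRingEnd ℂ (f w) := by
  have h := Complex.conjCLE.toContinuousLinearMap.circleAverage_comp_comm
    (circleIntegrable_poissonKernel_smul hw hf.continuousOn_sphere)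
  have h' := hf.circleAverage_poissonKernel_smul hw
  simp only [Pi.smul_def'] at h'
  rw [h'] at h
  simpa [Function.comp_def] using h

theorem circleAverage_poissonKernel_smul_re {f : ℂ → ℂ} {w : ℂ}
    (hf : DiffContOnCl ℂ f (Metric.ball 0 1)) (hw : w ∈ Metric.ball (0 : ℂ) 1) :
    Real.circleAverage (fun z ↦ poissonKernel 0 w z • (f z).re) 0 1 = (f w).re := by
  have h := Complex.reCLM.circleAverage_comp_comm
    (circleIntegrable_poissonKernel_smul hw hf.continuousOn_sphere)
  have h' := hf.circleAverage_poissonKernel_smul hw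
  simp only [Pi.smul_def'] at h'
  rw [h'] at h
  simpa [Function.comp_def] using h

/-- The Poisson integral of `conj ζ ^ n * F ζ`, estimated through a majorant of `‖F‖`. -/
theorem norm_conj_taylor_add_le_of_diffContOnCl {F G H : ℂ → ℂ} {c : ℕ → ℂ} {n : ℕ}
    (hG : DiffContOnCl ℂ G (Metric.ball 0 1)) (hH : DiffContOnCl ℂ H (Metric.ball 0 1))
    (hF : ∀ z ∈ Metric.sphere (0 : ℂ) 1, F z = ∑ j ∈ Finset.range n, c j * z ^ j + z ^ n * H z)
    (hFG : ∀ z ∈ Metric.sphere (0 : ℂ) 1, ‖F z‖ ≤ (G z).re)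
    {w : ℂ} (hw : w ∈ Metric.ball (0 : ℂ) 1) :
    ‖∑ j ∈ Finset.range n, c j * starRingEnd ℂ w ^ (n - j) + H w‖ ≤ (G w).re := by
  have key : ∑ j ∈ Finset.range n, c j * starRingEnd ℂ w ^ (n - j) + H w =
      Real.circleAverage (fun z ↦ poissonKernel 0 w z • (starRingEnd ℂ z ^ n * F z)) 0 1 := by
    have hsph : Real.circleAverage
          (fun z ↦ poissonKernel 0 w z • (starRingEnd ℂ z ^ n * F z)) 0 1 =
        Real.circleAverage (fun z ↦ (∑ j ∈ Finset.range n,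
          c j • (poissonKernel 0 w z • starRingEnd ℂ (z ^ (n - j))))
            + poissonKernel 0 w z • H z) 0 1 := by
      refine Real.circleAverage_congr_sphere fun z hz ↦ ?_
      rw [abs_one] at hz
      have hz1 : starRingEnd ℂ z * z = 1 := by
        rw [mem_sphere_zero_iff_norm] at hz
        rw [Complex.conj_mul', hz]; norm_num
      have hmul : starRingEnd ℂ z ^ n * F z =
          ∑ j ∈ Finset.range n, c j * starRingEnd ℂ z ^ (n - j) + H z := by
        rw [hF z hz, mul_add, Finset.mul_sum, ← mul_assoc, ← mul_pow, hz1, one_pow, one_mul]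
        congr 1
        refine Finset.sum_congr rfl fun j hj ↦ ?_
        obtain ⟨k, hk⟩ := Nat.exists_eq_add_of_le (Finset.mem_range.1 hj).le
        have : starRingEnd ℂ z ^ n * z ^ j = starRingEnd ℂ z ^ (n - j) := by
          rw [hk, Nat.add_sub_cancel_left, pow_add, mul_right_comm, ← mul_pow, hz1, one_pow,
            one_mul]
        rw [← this]; ring
      simp only [hmul, smul_add, Finset.smul_sum, map_pow, smul_eq_mul, Complex.real_smul]
      congr 1
      exact Finset.sum_congr rfl fun j _ ↦ by ring
    have hint : ∀ j, CircleIntegrable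
        (fun z ↦ c j • (poissonKernel 0 w z • starRingEnd ℂ (z ^ (n - j)))) 0 1 := fun j ↦
      (circleIntegrable_poissonKernel_smul hw (by fun_prop)).const_smul
    rw [hsph, Real.circleAverage_fun_add, Real.circleAverage_fun_sum fun j _ ↦ hint j]
    · congr 1
      · refine Finset.sum_congr rfl fun j _ ↦ ?_
        rw [Real.circleAverage_fun_smul, circleAverage_poissonKernel_smul_conj
          (f := fun z ↦ z ^ (n - j)) (Differentiable.diffContOnCl (by fun_prop)) hw]
        simp
      · exact (hH.circleAverage_poissonKernel_smul hw).symm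
    · exact CircleIntegrable.fun_sum _ fun j _ ↦ hint j
    · exact circleIntegrable_poissonKernel_smul hw hH.continuousOn_sphere
  rw [key, ← circleAverage_poissonKernel_smul_re hG hw]
  refine (norm_circleAverage_le_circleAverage_norm _ _ _).trans ?_
  have hFc : ContinuousOn F (Metric.sphere 0 1) := by
    refine ContinuousOn.congr (f := fun z ↦ ∑ j ∈ Finset.range n, c j * z ^ j + z ^ n * H z) ?_ hF
    have := hH.continuousOn_sphere
    fun_prop
  refine Real.circleAverage_mono ?_ ?_ fun z hz ↦ ?_
  · exact ((continuousOn_poissonKernel_zero hw).smul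
      (ContinuousOn.mul (by fun_prop) hFc)).norm.circleIntegrable zero_le_one
  · exact circleIntegrable_poissonKernel_smul hw
      (Complex.continuous_re.comp_continuousOn hG.continuousOn_sphere)
  · rw [abs_one] at hz
    have hz' := mem_sphere_zero_iff_norm.1 hz
    rw [norm_smul, Real.norm_of_nonneg (poissonKernel_zero_nonneg hw hz), norm_mul, norm_pow,
      Complex.norm_conj, hz', one_pow, one_mul, smul_eq_mul]
    exact mul_le_mul_of_nonneg_left (hFG z hz) (poissonKernel_zero_nonneg hw hz)

open Filter Topology in
theorem norm_conj_taylor_add_le {F G H : ℂ → ℂ} {c : ℕ → ℂ} {n : ℕ}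
    (hG : DifferentiableOn ℂ G (Metric.ball 0 1)) (hH : DifferentiableOn ℂ H (Metric.ball 0 1))
    (hF : ∀ z ∈ Metric.ball (0 : ℂ) 1, F z = ∑ j ∈ Finset.range n, c j * z ^ j + z ^ n * H z)
    (hFG : ∀ z ∈ Metric.ball (0 : ℂ) 1, ‖F z‖ ≤ (G z).re)
    {w : ℂ} (hw : w ∈ Metric.ball (0 : ℂ) 1) :
    ‖∑ j ∈ Finset.range n, c j * starRingEnd ℂ w ^ (n - j) + H w‖ ≤ (G w).re := by
  have hmem : ∀ s ∈ Set.Ioo (0 : ℝ) 1, ∀ z ∈ Metric.closedBall (0 : ℂ) 1,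
      (s : ℂ) * z ∈ Metric.ball (0 : ℂ) 1 := by
    intro s hs z hz
    rw [mem_closedBall_zero_iff] at hz
    rw [mem_ball_zero_iff, norm_mul, Complex.norm_real, Real.norm_of_nonneg hs.1.le]
    nlinarith [hs.1, hs.2]
  have hdil : ∀ s ∈ Set.Ioo (0 : ℝ) 1, ∀ f : ℂ → ℂ, DifferentiableOn ℂ f (Metric.ball 0 1) →
      DiffContOnCl ℂ (fun z ↦ f (s * z)) (Metric.ball 0 1) := by
    intro s hs f hf
    refine DifferentiableOn.diffContOnCl ?_
    rw [closure_ball 0 one_ne_zero]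
    exact hf.comp (by fun_prop) (hmem s hs)
  have hle : ∀ s ∈ Set.Ioo (0 : ℝ) 1,
      ‖∑ j ∈ Finset.range n, (c j * (s : ℂ) ^ j) * starRingEnd ℂ w ^ (n - j)
        + (s : ℂ) ^ n * H (s * w)‖ ≤ (G (s * w)).re := by
    intro s hs
    refine norm_conj_taylor_add_le_of_diffContOnCl (F := fun z ↦ F (s * z))
      (G := fun z ↦ G (s * z)) (H := fun z ↦ (s : ℂ) ^ n * H (s * z)) (hdil s hs G hG)
      ((hdil s hs H hH).const_smul ((s : ℂ) ^ n)) (fun z hz ↦ ?_) (fun z hz ↦ ?_) hw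
    · rw [hF _ (hmem s hs z (Metric.sphere_subset_closedBall hz)), mul_pow]
      congr 1
      · exact Finset.sum_congr rfl fun j _ ↦ by ring
      · ring
    · exact hFG _ (hmem s hs z (Metric.sphere_subset_closedBall hz))
  have hs : Tendsto (fun s : ℝ ↦ (s : ℂ)) (𝓝[<] 1) (𝓝 1) :=
    (Complex.continuous_ofReal.tendsto' 1 1 (by simp)).mono_left nhdsWithin_le_nhds
  have hsw : Tendsto (fun s : ℝ ↦ (s : ℂ) * w) (𝓝[<] 1) (𝓝 w) := by
    simpa using hs.mul_const w
  have hcont : ∀ f : ℂ → ℂ, DifferentiableOn ℂ f (Metric.ball 0 1) →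
      Tendsto (fun s : ℝ ↦ f ((s : ℂ) * w)) (𝓝[<] 1) (𝓝 (f w)) := fun f hf ↦
    (hf.continuousOn.continuousAt (Metric.isOpen_ball.mem_nhds hw)).tendsto.comp hsw
  refine le_of_tendsto_of_tendsto ?_ ((Complex.continuous_re.tendsto _).comp (hcont G hG))
    (eventually_of_mem (Ioo_mem_nhdsLT (zero_lt_one' ℝ)) hle)
  refine Tendsto.norm (Tendsto.add (tendsto_finsetSum _ fun j _ ↦ ?_) ?_)
  · simpa using ((hs.pow j).const_mul (c j)).mul_const (starRingEnd ℂ w ^ (n - j))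
  · simpa using (hs.pow n).mul (hcont H hH)

theorem norm_sub_poissonPartialSum_le {F G H : ℂ → ℂ} {c : ℕ → ℂ} {n : ℕ}
    (hG : DifferentiableOn ℂ G (Metric.ball 0 1)) (hH : DifferentiableOn ℂ H (Metric.ball 0 1))
    (hF : ∀ z ∈ Metric.ball (0 : ℂ) 1, F z = ∑ j ∈ Finset.range n, c j * z ^ j + z ^ n * H z)
    (hFG : ∀ z ∈ Metric.ball (0 : ℂ) 1, ‖F z‖ ≤ (G z).re)
    {r : ℝ} (hr0 : 0 ≤ r) (hr1 : r < 1) {z : ℂ} (hz : ‖z‖ = 1) :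
    ‖F (r * z) - ∑ j ∈ Finset.range n, c j * ((r : ℂ) ^ j - (r : ℂ) ^ (2 * n - j)) * z ^ j‖
      ≤ r ^ n * (G (r * z)).re := by
  have hw : (r : ℂ) * z ∈ Metric.ball (0 : ℂ) 1 := by
    rw [mem_ball_zero_iff, norm_mul, Complex.norm_real, Real.norm_of_nonneg hr0, hz, mul_one]
    exact hr1
  have hz1 : starRingEnd ℂ z * z = 1 := by rw [Complex.conj_mul', hz]; norm_num
  have heq : F (r * z) - ∑ j ∈ Finset.range n,
        c j * ((r : ℂ) ^ j - (r : ℂ) ^ (2 * n - j)) * z ^ j =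
      (r : ℂ) ^ n * z ^ n *
        (∑ j ∈ Finset.range n, c j * starRingEnd ℂ (r * z) ^ (n - j) + H (r * z)) := by
    rw [hF _ hw, mul_add, Finset.mul_sum, add_sub_right_comm, ← Finset.sum_sub_distrib, mul_pow]
    congr 1
    refine Finset.sum_congr rfl fun j hj ↦ ?_
    obtain ⟨k, rfl⟩ := Nat.exists_eq_add_of_le (Finset.mem_range.1 hj).le
    have h1 : 2 * (j + k) - j = j + k + k := by omega
    rw [Nat.add_sub_cancel_left, h1, map_mul, Complex.conj_ofReal, mul_pow, mul_pow]
    have h2 : z ^ (j + k) * starRingEnd ℂ z ^ k = z ^ j := by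
      rw [pow_add, mul_assoc, ← mul_pow, mul_comm z, hz1, one_pow, mul_one]
    calc _ = c j * (r : ℂ) ^ (j + k + k) * z ^ j := by ring
      _ = _ := by rw [← h2]; ring
  rw [heq, norm_mul, norm_mul, norm_pow, norm_pow, hz, one_pow, mul_one, Complex.norm_real,
    Real.norm_of_nonneg hr0]
  exact mul_le_mul_of_nonneg_left (norm_conj_taylor_add_le hG hH hF hFG hw) (pow_nonneg hr0 n)

theorem exists_taylor_remainder {F : ℂ → ℂ} (hF : DifferentiableOn ℂ F (Metric.ball 0 1)) (n : ℕ) :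
    ∃ (c : ℕ → ℂ) (H : ℂ → ℂ), DifferentiableOn ℂ H (Metric.ball 0 1) ∧
      ∀ z, F z = ∑ j ∈ Finset.range n, c j * z ^ j + z ^ n * H z := by
  induction n with
  | zero => exact ⟨0, F, hF, by simp⟩
  | succ n ih =>
    obtain ⟨c, H, hH, hc⟩ := ih
    refine ⟨Function.update c n (H 0), dslope H 0,
      (Complex.differentiableOn_dslope (Metric.ball_mem_nhds _ zero_lt_one)).2 hH, fun z ↦ ?_⟩
    have h := sub_smul_dslope H 0 z
    rw [sub_zero, smul_eq_mul] at h
    rw [hc z, Finset.sum_range_succ, Function.update_self]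
    have : ∑ j ∈ Finset.range n, Function.update c n (H 0) j * z ^ j =
        ∑ j ∈ Finset.range n, c j * z ^ j := Finset.sum_congr rfl fun j hj ↦ by
      rw [Function.update_of_ne (Finset.mem_range.1 hj).ne]
    rw [this, pow_succ, mul_assoc, h]
    ring

theorem exp_mul_le_one_add {K A x : ℝ} (hA : 0 < A) (hx0 : 0 ≤ x) (hxA : x ≤ A) :
    Real.exp (K * x) ≤ 1 + Real.exp (K * A) / A * x := by
  have ht0 : 0 ≤ x / A := div_nonneg hx0 hA.le
  have ht1 : x / A ≤ 1 := (div_le_one hA).2 hxA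
  have h := convexOn_exp.2 (Set.mem_univ (0 : ℝ)) (Set.mem_univ (K * A)) (sub_nonneg.2 ht1) ht0
    (by ring)
  have e : (1 - x / A) • (0 : ℝ) + (x / A) • (K * A) = K * x := by
    simp only [smul_eq_mul]; field_simp; ring
  rw [e] at h
  simp only [smul_eq_mul, Real.exp_zero, mul_one] at h
  calc Real.exp (K * x) ≤ 1 - x / A + x / A * Real.exp (K * A) := h
    _ ≤ 1 + x / A * Real.exp (K * A) := by linarith
    _ = _ := by ring

theorem one_sub_inv_pow_le_exp {K A : ℝ} {n : ℕ} (hA : 1 < A) (hn : K * A ^ 2 ≤ n) :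
    (1 - 1 / A) ^ n ≤ Real.exp (-(K * A)) := by
  have hA0 : 0 < A := by linarith
  have h0 : 0 ≤ 1 - 1 / A := sub_nonneg.2 ((div_le_one hA0).2 hA.le)
  calc (1 - 1 / A) ^ n ≤ Real.exp (-(1 / A)) ^ n := by
        gcongr
        linarith [Real.add_one_le_exp (-(1 / A))]
    _ = Real.exp (n * -(1 / A)) := (Real.exp_nat_mul _ _).symm
    _ ≤ Real.exp (-(K * A)) := by
        refine Real.exp_le_exp.2 ?_
        have : K * A ≤ n * (1 / A) := by
          rw [mul_one_div, le_div_iff₀ hA0]; nlinarith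
        linarith

/-- Polynomial approximation of the dilation of the normalized exponential of an analytic function
with values in a strip. -/
theorem exists_polynomial_norm_one_sub_le {h : ℂ → ℂ} {K A : ℝ} {n : ℕ}
    (hh : DifferentiableOn ℂ h (Metric.ball 0 1))
    (h0 : ∀ z ∈ Metric.ball (0 : ℂ) 1, 0 ≤ (h z).re)
    (hA : ∀ z ∈ Metric.ball (0 : ℂ) 1, (h z).re ≤ A)
    (hK : 0 < K) (hA1 : 1 < A) (hKA : 20 ≤ K * A) (hn : K * A ^ 2 ≤ n) :
    ∃ Q : Polynomial ℂ, Q.natDegree ≤ n ∧ Q.eval 0 = 0 ∧ ∀ z : ℂ, ‖z‖ = 1 →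
      ‖1 - Q.eval z‖ ^ 2 ≤
        2 * Real.exp (2 * K * ((h (((1 - 1 / A : ℝ) : ℂ) * z)).re - (h 0).re)) := by
  have hA0 : 0 < A := by linarith
  set r : ℝ := 1 - 1 / A with hr
  have hr0 : 0 ≤ r := sub_nonneg.2 ((div_le_one hA0).2 hA1.le)
  have hr1 : r < 1 := by have : 0 < 1 / A := by positivity
                         linarith
  have hrn : r ^ n ≤ Real.exp (-(K * A)) := one_sub_inv_pow_le_exp hA1 hn
  have hexp : Real.exp (-(K * A)) ≤ 1 / (K * A) := by
    rw [Real.exp_neg, ← one_div]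
    exact one_div_le_one_div_of_le (by linarith) (by linarith [Real.add_one_le_exp (K * A)])
  have hinv : 1 / (K * A) ≤ 1 / 20 := one_div_le_one_div_of_le (by norm_num) hKA
  have hnpos : 0 < n := by
    have : (0 : ℝ) < n := lt_of_lt_of_le (by positivity) hn
    exact_mod_cast this
  set F : ℂ → ℂ := fun z ↦ Complex.exp (K * h z) with hFdef
  have hFn : ∀ z, ‖F z‖ = Real.exp (K * (h z).re) := fun z ↦ by simp [hFdef, Complex.norm_exp]
  set B : ℝ := Real.exp (K * A) / A with hB
  obtain ⟨c, H, hH, hc⟩ := exists_taylor_remainder (F := F) (by fun_prop) n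
  have hc0 : c 0 = F 0 := by
    obtain ⟨m, rfl⟩ := Nat.exists_eq_succ_of_ne_zero hnpos.ne'
    rw [hc 0, Finset.sum_range_succ']; simp
  set p : Polynomial ℂ := ∑ j ∈ Finset.range n,
    Polynomial.monomial j (c j * ((r : ℂ) ^ j - (r : ℂ) ^ (2 * n - j))) with hp
  have hpe : ∀ z, p.eval z =
      ∑ j ∈ Finset.range n, c j * ((r : ℂ) ^ j - (r : ℂ) ^ (2 * n - j)) * z ^ j := fun z ↦ by
    simp [hp, Polynomial.eval_finsetSum, Polynomial.eval_monomial]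
  have hpdeg : p.natDegree ≤ n := Polynomial.natDegree_sum_le_of_forall_le _ _ fun j hj ↦
    (Polynomial.natDegree_monomial_le _).trans (Finset.mem_range.1 hj).le
  have hp0 : p.eval 0 = F 0 * (1 - (r : ℂ) ^ (2 * n)) := by
    obtain ⟨m, rfl⟩ := Nat.exists_eq_succ_of_ne_zero hnpos.ne'
    rw [hpe, Finset.sum_range_succ']; simp [hc0]
  have hr2n : r ^ (2 * n) ≤ 1 / 20 := by
    rw [two_mul, pow_add]
    have := pow_nonneg hr0 n
    nlinarith
  have hp0n : 19 / 20 * Real.exp (K * (h 0).re) ≤ ‖p.eval 0‖ := by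
    have : (1 : ℂ) - (r : ℂ) ^ (2 * n) = ((1 - r ^ (2 * n) : ℝ) : ℂ) := by push_cast; rfl
    rw [hp0, norm_mul, hFn, this, Complex.norm_real, mul_comm]
    refine mul_le_mul_of_nonneg_left ?_ (Real.exp_pos _).le
    exact le_trans (by linarith) (le_abs_self _)
  have hp0pos : 0 < ‖p.eval 0‖ := lt_of_lt_of_le (by positivity) hp0n
  have hpz : ∀ z : ℂ, ‖z‖ = 1 → ‖p.eval z‖ ≤ 11 / 10 * Real.exp (K * (h (r * z)).re) := by
    intro z hz
    have hw : (r : ℂ) * z ∈ Metric.ball (0 : ℂ) 1 := by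
      rw [mem_ball_zero_iff, norm_mul, Complex.norm_real, Real.norm_of_nonneg hr0, hz, mul_one]
      exact hr1
    have hGF : ∀ z ∈ Metric.ball (0 : ℂ) 1, ‖F z‖ ≤ (1 + (B : ℂ) * h z).re := fun z hz ↦ by
      rw [hFn]
      simpa using exp_mul_le_one_add hA0 (h0 z hz) (hA z hz)
    have herr := norm_sub_poissonPartialSum_le (G := fun z ↦ 1 + (B : ℂ) * h z) (by fun_prop) hH
      (fun z _ ↦ hc z) hGF hr0 hr1 hz
    rw [← hpe] at herr
    set x := (h (r * z)).re with hx
    have hx0 : 0 ≤ x := h0 _ hw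
    have hG : (1 + (B : ℂ) * h (r * z)).re = 1 + B * x := by simp [hx]
    rw [hG] at herr
    have hKx := Real.add_one_le_exp (K * x)
    have hKx0 : 0 ≤ K * x := by positivity
    have herr' : r ^ n * (1 + B * x) ≤ 1 / 10 * Real.exp (K * x) := by
      calc r ^ n * (1 + B * x) ≤ Real.exp (-(K * A)) * (1 + B * x) :=
            mul_le_mul_of_nonneg_right hrn (by positivity)
        _ = Real.exp (-(K * A)) + 1 / (K * A) * (K * x) := by
            have : Real.exp (-(K * A)) * Real.exp (K * A) = 1 := by
              rw [← Real.exp_add]; simp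
            rw [hB]
            field_simp
            linear_combination x * this
        _ ≤ 1 / 20 * 1 + 1 / 20 * (K * x) := by gcongr; linarith
        _ ≤ 1 / 10 * Real.exp (K * x) := by linarith
    calc ‖p.eval z‖ = ‖F (r * z) - (F (r * z) - p.eval z)‖ := by congr 1; ring
      _ ≤ ‖F (r * z)‖ + ‖F (r * z) - p.eval z‖ := norm_sub_le _ _
      _ ≤ 11 / 10 * Real.exp (K * x) := by rw [hFn]; linarith
  have hp0ne : p.eval 0 ≠ 0 := norm_pos_iff.1 hp0pos
  refine ⟨1 - Polynomial.C (p.eval 0)⁻¹ * p, ?_, ?_, fun z hz ↦ ?_⟩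
  · refine (Polynomial.natDegree_sub_le _ _).trans (max_le (by simp) ?_)
    exact (Polynomial.natDegree_C_mul_le _ _).trans hpdeg
  · simp [hp0ne]
  · have e : (1 : ℂ) - (1 - Polynomial.C (p.eval 0)⁻¹ * p).eval z = p.eval z / p.eval 0 := by
      simp [div_eq_inv_mul]
    rw [e, norm_div]
    have hE : Real.exp (2 * K * ((h (r * z)).re - (h 0).re)) =
        (Real.exp (K * (h (r * z)).re) / Real.exp (K * (h 0).re)) ^ 2 := by
      rw [← Real.exp_sub, ← Real.exp_nat_mul]; congr 1; push_cast; ring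
    have hb : ‖p.eval z‖ / ‖p.eval 0‖ ≤
        22 / 19 * (Real.exp (K * (h (r * z)).re) / Real.exp (K * (h 0).re)) := by
      calc _ ≤ 11 / 10 * Real.exp (K * (h (r * z)).re) /
            (19 / 20 * Real.exp (K * (h 0).re)) := by
            have := hpz z hz
            gcongr
        _ = _ := by field_simp; norm_num
    rw [hE]
    calc _ ≤ (22 / 19 * (Real.exp (K * (h (r * z)).re) / Real.exp (K * (h 0).re))) ^ 2 := by
          gcongr
      _ ≤ _ := by
          rw [mul_pow]
          exact mul_le_mul_of_nonneg_right (by norm_num) (sq_nonneg _)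

theorem circleAverage_zero_one_eq (f : ℂ → ℝ) :
    Real.circleAverage f 0 1 =
      (2 * Real.pi)⁻¹ * ∫ θ in (-Real.pi)..Real.pi, f (Complex.exp ((θ : ℂ) * Complex.I)) := by
  have hper : Function.Periodic (fun θ ↦ f (circleMap 0 1 θ)) (2 * Real.pi) :=
    fun x ↦ by simp [periodic_circleMap 0 1 x]
  have h := hper.intervalIntegral_add_eq 0 (-Real.pi)
  rw [zero_add, show -Real.pi + 2 * Real.pi = Real.pi by ring] at h
  rw [Real.circleAverage_def, h, smul_eq_mul]
  simp [circleMap]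

theorem poissonKernel_zero_eq_poissonKer (r θ φ : ℝ) :
    poissonKernel 0 ((r : ℂ) * Complex.exp ((θ : ℂ) * Complex.I))
      (Complex.exp ((φ : ℂ) * Complex.I)) = poissonKer r (θ - φ) := by
  rw [poissonKernel_def, poissonKer, sub_zero, sub_zero, norm_mul, Complex.norm_exp_ofReal_mul_I,
    Complex.norm_exp_ofReal_mul_I, Complex.norm_real, mul_one, Real.norm_eq_abs, sq_abs, one_pow,
    ← Complex.normSq_eq_norm_sq, Complex.normSq_apply]
  congr 1
  simp only [Complex.sub_re, Complex.sub_im, Complex.mul_re, Complex.mul_im, Complex.ofReal_re,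
    Complex.ofReal_im, Complex.exp_ofReal_mul_I_re, Complex.exp_ofReal_mul_I_im, Real.cos_sub]
  linear_combination Real.sin_sq_add_cos_sq φ + r ^ 2 * Real.sin_sq_add_cos_sq θ

theorem circleIntegrable_of_measurable_of_bound {g : ℂ → ℝ} (hg : Measurable g) {A : ℝ}
    (hA : ∀ z, |g z| ≤ A) (c : ℂ) (R : ℝ) : CircleIntegrable g c R := by
  rw [CircleIntegrable, intervalIntegrable_iff]
  exact Measure.integrableOn_of_bounded (M := A) measure_Ioc_lt_top.ne
    (hg.comp (continuous_circleMap c R).measurable).aestronglyMeasurable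
    (Filter.Eventually.of_forall fun θ ↦ hA _)

theorem circleAverage_poissonKernel {w : ℂ} (hw : w ∈ Metric.ball (0 : ℂ) 1) :
    Real.circleAverage (poissonKernel 0 w) 0 1 = 1 := by
  simpa using circleAverage_poissonKernel_smul_re (f := fun _ ↦ 1) diffContOnCl_const hw

/-- The Herglotz transform of a bounded nonnegative function on the unit circle. -/
theorem exists_herglotz_transform {g : ℂ → ℝ} (hg : Measurable g) {A : ℝ}
    (hg0 : ∀ z, 0 ≤ g z) (hgA : ∀ z, g z ≤ A) :
    ∃ h : ℂ → ℂ, DifferentiableOn ℂ h (Metric.ball 0 1) ∧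
      (∀ w ∈ Metric.ball (0 : ℂ) 1,
        (h w).re = Real.circleAverage (fun z ↦ g z * poissonKernel 0 w z) 0 1) ∧
      (∀ w ∈ Metric.ball (0 : ℂ) 1, 0 ≤ (h w).re) ∧
      (∀ w ∈ Metric.ball (0 : ℂ) 1, (h w).re ≤ A) ∧
      (h 0).re = Real.circleAverage g 0 1 := by
  have hint : CircleIntegrable g 0 1 := circleIntegrable_of_measurable_of_bound hg
    (fun z ↦ by rw [abs_of_nonneg (hg0 z)]; exact hgA z) 0 1
  have hintC : CircleIntegrable (fun z ↦ (g z : ℂ)) 0 1 := by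
    simp only [CircleIntegrable, intervalIntegrable_iff] at hint ⊢
    exact Complex.ofRealCLM.integrable_comp hint
  have hre : ∀ w ∈ Metric.ball (0 : ℂ) 1,
      (Real.circleAverage (fun ζ ↦ herglotzRieszKernel 0 w ζ • (g ζ : ℂ)) 0 1).re =
        Real.circleAverage (fun z ↦ g z * poissonKernel 0 w z) 0 1 := fun w hw ↦ by
    rw [re_circleAverage_herglotzRieszKernel_smul hint hw, ← poissonKernel_eq_re_herglotzRieszKernel]
    congr 1
    ext z
    simp [mul_comm]
  refine ⟨_, differentiableOn_circleAverage_herglotzRieszKernel_smul hintC, hre, fun w hw ↦ ?_,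
    fun w hw ↦ ?_, ?_⟩
  · rw [hre w hw]
    refine Real.circleAverage_nonneg_of_nonneg fun z hz ↦ ?_
    rw [abs_one] at hz
    exact mul_nonneg (hg0 z) (poissonKernel_zero_nonneg hw hz)
  · have hP := continuousOn_poissonKernel_zero hw
    have hA : Real.circleAverage (fun z ↦ A • poissonKernel 0 w z) 0 1 = A := by
      rw [Real.circleAverage_fun_smul, circleAverage_poissonKernel hw, smul_eq_mul, mul_one]
    rw [hre w hw, ← hA]
    refine Real.circleAverage_mono (hint.mul_continuousOn (by simpa using hP))
      ((hP.const_smul A).circleIntegrable zero_le_one) fun z hz ↦ ?_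
    rw [abs_one] at hz
    exact mul_le_mul_of_nonneg_right (hgA z) (poissonKernel_zero_nonneg hw hz)
  · rw [hre 0 (Metric.mem_ball_self zero_lt_one)]
    refine Real.circleAverage_congr_sphere fun z hz ↦ ?_
    rw [abs_one, mem_sphere_zero_iff_norm] at hz
    simp [poissonKernel_def, hz]

theorem eN_le_of_forall_norm_sq_le {ρ : Measure ℂ} (hρ : ρ {z : ℂ | ‖z‖ ≠ 1} = 0) {n : ℕ}
    {Q : Polynomial ℂ} (hQn : Q.natDegree ≤ n) (hQ0 : Q.eval 0 = 0) {V : ℂ → ℝ≥0∞} {D C : ℝ}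
    (hD : 0 ≤ D) (hC : 0 ≤ C)
    (hQ : ∀ z : ℂ, ‖z‖ = 1 → ENNReal.ofReal (‖1 - Q.eval z‖ ^ 2) ≤ ENNReal.ofReal D * V z)
    (hV : ∫⁻ z, V z ∂ρ ≤ ENNReal.ofReal C) :
    eN ρ n ≤ Real.sqrt (D * C) := by
  have hbdd : BddBelow {r : ℝ | ∃ Q : Polynomial ℂ, Q.natDegree ≤ n ∧ Q.eval 0 = 0 ∧
      r = (∫ z, ‖(1 : ℂ) - Q.eval z‖ ^ 2 ∂ρ) ^ (1 / 2 : ℝ)} := by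
    refine ⟨0, ?_⟩
    rintro _ ⟨Q, -, -, rfl⟩
    exact Real.rpow_nonneg (integral_nonneg fun z ↦ sq_nonneg _) _
  refine (csInf_le hbdd ⟨Q, hQn, hQ0, rfl⟩).trans ?_
  rw [← Real.sqrt_eq_rpow]
  refine Real.sqrt_le_sqrt ?_
  have hcont : Continuous fun z : ℂ ↦ ‖(1 : ℂ) - Q.eval z‖ ^ 2 := by
    have := Q.continuous
    fun_prop
  rw [integral_eq_lintegral_of_nonneg_ae (Filter.Eventually.of_forall fun z ↦ sq_nonneg _)
    hcont.aestronglyMeasurable]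
  refine ENNReal.toReal_le_of_le_ofReal (mul_nonneg hD hC) ?_
  calc ∫⁻ z, ENNReal.ofReal (‖(1 : ℂ) - Q.eval z‖ ^ 2) ∂ρ
      ≤ ∫⁻ z, ENNReal.ofReal D * V z ∂ρ := by
        refine lintegral_mono_ae ?_
        have : ∀ᵐ z ∂ρ, ‖z‖ = 1 := ae_iff.2 hρ
        filter_upwards [this] with z hz using hQ z hz
    _ = ENNReal.ofReal D * ∫⁻ z, V z ∂ρ := lintegral_const_mul' _ _ ENNReal.ofReal_ne_top
    _ ≤ ENNReal.ofReal D * ENNReal.ofReal C := by gcongr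
    _ = ENNReal.ofReal (D * C) := (ENNReal.ofReal_mul hD).symm

/-- upper bound for `e_n(ρ)`: there is a threshold
`A₀(β, M)` such that for any finite measure `ρ` on the unit circle, any
measurable `W : 𝕋 → [1,∞]` with `∫ W^β dρ ≤ C` and with
`(log W_A) * P_{1-1/A} ≤ M log W` pointwise (stated equivalently in
exponentiated form, which avoids `log ∞`), and any `A ≥ A₀(β, M)`,
`n ≥ A²β/(2M)`:
`e_n(ρ) ≤ sqrt(2C + ρ(𝕋)/2) · exp(−(β/2M) ∫ log W_A dm)`,
`m` being normalized Lebesgue measure on `𝕋`. -/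
theorem stmt12 : ∃ A₀ : ℝ → ℝ → ℝ, ∀ β M : ℝ, 0 < β → 0 < M →
    ∀ A : ℝ, A₀ β M ≤ A → 1 < A →
    ∀ (ρ : Measure ℂ), IsFiniteMeasure ρ → ρ {z : ℂ | ‖z‖ ≠ 1} = 0 →
    ∀ (W : ℂ → ℝ≥0∞), Measurable W → (∀ z, 1 ≤ W z) →
    ∀ C : ℝ, 0 < C →
    (∫⁻ z, W z ^ β ∂ρ) ≤ ENNReal.ofReal C →
    (∀ θ : ℝ, ENNReal.ofReal (Real.exp (M⁻¹ *
        ((2 * Real.pi)⁻¹ *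
          ∫ φ in (-Real.pi)..Real.pi, logWA W A φ * poissonKer (1 - 1 / A) (θ - φ)))) ≤
      W (Complex.exp ((θ : ℂ) * Complex.I))) →
    ∀ n : ℕ, A ^ 2 * β / (2 * M) ≤ (n : ℝ) →
      eN ρ n ≤ Real.sqrt (2 * C + (ρ Set.univ).toReal / 2) *
        Real.exp (-(β / (2 * M)) *
          ((2 * Real.pi)⁻¹ * ∫ θ in (-Real.pi)..Real.pi, logWA W A θ)) := by
  refine ⟨fun β M ↦ 40 * M / β, fun β M hβ hM A hA₀ hA1 ρ _ hρ W hW hW1 C hC hWC hPW n hn ↦ ?_⟩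
  have hA0 : 0 < A := by linarith
  set K : ℝ := β / (2 * M) with hKdef
  have hK : 0 < K := by positivity
  have hKA : 20 ≤ K * A := by
    rw [div_le_iff₀ hβ] at hA₀
    rw [hKdef, div_mul_eq_mul_div, le_div_iff₀ (by positivity)]
    linarith
  have hKn : K * A ^ 2 ≤ n := le_of_eq_of_le (by rw [hKdef]; ring) hn
  set g : ℂ → ℝ := fun z ↦ Real.log (min (W z) (ENNReal.ofReal (Real.exp A))).toReal with hg
  have hgm : Measurable g := by fun_prop
  have hmin : ∀ z, 1 ≤ (min (W z) (ENNReal.ofReal (Real.exp A))).toReal := fun z ↦ by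
    rw [← ENNReal.toReal_one]
    refine ENNReal.toReal_mono ((min_le_right _ _).trans_lt ENNReal.ofReal_lt_top).ne
      (le_min (hW1 z) ?_)
    rw [← ENNReal.ofReal_one]
    exact ENNReal.ofReal_le_ofReal (Real.one_le_exp hA0.le)
  have hg0 : ∀ z, 0 ≤ g z := fun z ↦ Real.log_nonneg (hmin z)
  have hgA : ∀ z, g z ≤ A := fun z ↦ by
    rw [hg, Real.log_le_iff_le_exp (by linarith [hmin z])]
    exact ENNReal.toReal_le_of_le_ofReal (Real.exp_pos A).le (min_le_right _ _)
  obtain ⟨h, hhd, hhP, hh0, hhA, hh00⟩ := exists_herglotz_transform hgm hg0 hgA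
  obtain ⟨Q, hQn, hQ0, hQ⟩ := exists_polynomial_norm_one_sub_le hhd hh0 hhA hK hA1 hKA hKn
  set L : ℝ := (2 * Real.pi)⁻¹ * ∫ θ in (-Real.pi)..Real.pi, logWA W A θ with hL
  have hhL : (h 0).re = L := by rw [hh00, circleAverage_zero_one_eq]; rfl
  have hr0 : 0 ≤ 1 - 1 / A := sub_nonneg.2 ((div_le_one hA0).2 hA1.le)
  have hr1 : 1 - 1 / A < 1 := by
    have : 0 < 1 / A := by positivity
    linarith
  have hQW : ∀ z : ℂ, ‖z‖ = 1 → ENNReal.ofReal (‖1 - Q.eval z‖ ^ 2) ≤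
      ENNReal.ofReal (2 * Real.exp (-(2 * K * L))) * W z ^ β := by
    intro z hz
    obtain ⟨θ, rfl⟩ : ∃ θ : ℝ, z = Complex.exp ((θ : ℂ) * Complex.I) :=
      ⟨z.arg, by simpa [hz] using (Complex.norm_mul_exp_arg_mul_I z).symm⟩
    have hw : ((1 - 1 / A : ℝ) : ℂ) * Complex.exp ((θ : ℂ) * Complex.I) ∈
        Metric.ball (0 : ℂ) 1 := by
      rw [mem_ball_zero_iff, norm_mul, Complex.norm_real, Real.norm_of_nonneg hr0, hz, mul_one]
      exact hr1
    have hx := hhP _ hw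
    rw [circleAverage_zero_one_eq] at hx
    simp only [poissonKernel_zero_eq_poissonKer] at hx
    have hWθ := hPW θ
    change ENNReal.ofReal (Real.exp (M⁻¹ * ((2 * Real.pi)⁻¹ * ∫ φ in (-Real.pi)..Real.pi,
      g (Complex.exp ((φ : ℂ) * Complex.I)) * poissonKer (1 - 1 / A) (θ - φ)))) ≤ _ at hWθ
    rw [← hx] at hWθ
    have hWβ := ENNReal.rpow_le_rpow hWθ hβ.le
    rw [ENNReal.ofReal_rpow_of_pos (Real.exp_pos _), ← Real.exp_mul] at hWβ
    refine (ENNReal.ofReal_le_ofReal (hQ _ hz)).trans ?_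
    have e : ∀ x : ℝ, 2 * Real.exp (2 * K * (x - (h 0).re)) =
        2 * Real.exp (-(2 * K * L)) * Real.exp (M⁻¹ * x * β) := fun x ↦ by
      rw [mul_assoc 2 (Real.exp _), ← Real.exp_add, hhL, hKdef]
      congr 2
      field_simp
      ring
    rw [e, ENNReal.ofReal_mul (by positivity)]
    gcongr
  refine (eN_le_of_forall_norm_sq_le hρ hQn hQ0 (by positivity) hC.le hQW hWC).trans ?_
  have hE : Real.exp (-K * L) = Real.sqrt (Real.exp (-(2 * K * L))) := by
    rw [← Real.exp_half]
    congr 1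
    ring
  rw [hE, ← Real.sqrt_mul (by positivity)]
  refine Real.sqrt_le_sqrt ?_
  have hE0 := Real.exp_pos (-(2 * K * L))
  have hρ0 : 0 ≤ (ρ Set.univ).toReal := ENNReal.toReal_nonneg
  nlinarith [mul_nonneg hρ0 hE0.le]
end

section
/- Let ρ be a positive measure on 𝕋 with dρ(e^{iθ}) ≥ c·exp(−β/|θ|) dm for all θ ∈ [−π,π] and some c, β > 0. Then there is a constant c_β > 0 with e_n(ρ) ≥ c_β · n^{−β/(2π)} for all n ≥ 1; in particular, Σ_n e_n(ρ)² = ∞ when β ≤ π. -/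
open MeasureTheory

/-- Normalized Lebesgue (Haar) measure on the unit circle, as a measure on
`ℂ`. -/
noncomputable def mCircle : Measure ℂ :=
  Measure.map (fun θ : ℝ => Complex.exp ((θ : ℂ) * Complex.I))
    ((ENNReal.ofReal (2 * Real.pi))⁻¹ • volume.restrict (Set.Ioc (-Real.pi) Real.pi))

/-- The circle average over the unit circle, written as an integral over `(-π, π]`. -/
theorem circleAverage_zero_one_eq_setIntegral (f : ℂ → ℝ) :
    Real.circleAverage f 0 1 =
      (2 * Real.pi)⁻¹ * ∫ θ in Set.Ioc (-Real.pi) Real.pi, f (circleMap 0 1 θ) := by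
  have hper : (fun θ ↦ f (circleMap 0 1 θ)).Periodic (2 * Real.pi) :=
    fun x ↦ by simp [periodic_circleMap 0 1 x]
  have h := hper.intervalIntegral_add_eq 0 (-Real.pi)
  rw [zero_add, show -Real.pi + 2 * Real.pi = Real.pi by ring] at h
  rw [Real.circleAverage_def, h, intervalIntegral.integral_of_le (by linarith [Real.pi_pos]),
    smul_eq_mul]

/-- On the unit circle a polynomial is controlled by its `L²` norm and its degree. -/
theorem Polynomial.norm_eval_sq_le_circleAverage (P : Polynomial ℂ) {n : ℕ}
    (hP : P.natDegree ≤ n) {z : ℂ} (hz : ‖z‖ = 1) :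
    ‖P.eval z‖ ^ 2 ≤ (n + 1) * Real.circleAverage (fun w ↦ ‖P.eval w‖ ^ 2) 0 1 := by
  have hcard : (P.support.card : ℝ) ≤ n + 1 := by
    have := P.card_supp_le_succ_natDegree
    exact_mod_cast this.trans (by omega)
  rw [← P.sum_sq_norm_coeff_eq_circleAverage]
  have h1 : ‖P.eval z‖ ≤ ∑ i ∈ P.support, ‖P.coeff i‖ := by
    rw [Polynomial.eval_eq_sum, Polynomial.sum]
    refine (norm_sum_le _ _).trans (Finset.sum_le_sum fun i _ ↦ ?_)
    simp [hz]
  calc ‖P.eval z‖ ^ 2 ≤ (∑ i ∈ P.support, ‖P.coeff i‖) ^ 2 := by gcongr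
    _ ≤ P.support.card * ∑ i ∈ P.support, ‖P.coeff i‖ ^ 2 := sq_sum_le_card_mul_sum_sq
    _ ≤ (n + 1) * ∑ i ∈ P.support, ‖P.coeff i‖ ^ 2 := by gcongr

theorem integral_inv_max_abs {δ : ℝ} (hδ : 0 < δ) (hδπ : δ ≤ Real.pi) :
    ∫ θ in Set.Ioc (-Real.pi) Real.pi, (max |θ| δ)⁻¹ =
      2 * (1 + Real.log (Real.pi / δ)) := by
  have hcont : Continuous fun θ : ℝ ↦ (max |θ| δ)⁻¹ :=
    (by fun_prop : Continuous fun θ : ℝ ↦ max |θ| δ).inv₀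
      fun θ ↦ (lt_max_of_lt_right hδ).ne'
  have hint (a b : ℝ) : IntervalIntegrable (fun θ : ℝ ↦ (max |θ| δ)⁻¹) volume a b :=
    hcont.intervalIntegrable a b
  have hright : ∫ θ in δ..Real.pi, (max |θ| δ)⁻¹ = Real.log (Real.pi / δ) := by
    rw [← integral_inv_of_pos hδ Real.pi_pos]
    refine intervalIntegral.integral_congr fun θ hθ ↦ ?_
    rw [Set.uIcc_of_le hδπ] at hθ
    simp only [abs_of_pos (hδ.trans_le hθ.1), max_eq_left hθ.1]
  have hmid : ∫ θ in (0 : ℝ)..δ, (max |θ| δ)⁻¹ = 1 := by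
    rw [intervalIntegral.integral_congr (g := fun _ ↦ δ⁻¹)]
    · simp [hδ.ne']
    · intro θ hθ
      rw [Set.uIcc_of_le hδ.le] at hθ
      simp only [abs_of_nonneg hθ.1, max_eq_right hθ.2]
  have hhalf : ∫ θ in (0 : ℝ)..Real.pi, (max |θ| δ)⁻¹ = 1 + Real.log (Real.pi / δ) := by
    rw [← intervalIntegral.integral_add_adjacent_intervals (hint 0 δ) (hint δ Real.pi),
      hmid, hright]
  have hneg : ∫ θ in (-Real.pi)..0, (max |θ| δ)⁻¹ = ∫ θ in (0 : ℝ)..Real.pi, (max |θ| δ)⁻¹ := by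
    have := intervalIntegral.integral_comp_neg (a := 0) (b := Real.pi)
      (fun θ : ℝ ↦ (max |θ| δ)⁻¹)
    simpa using this.symm
  rw [← intervalIntegral.integral_of_le (by linarith [Real.pi_pos]),
    ← intervalIntegral.integral_add_adjacent_intervals (hint _ 0) (hint 0 _), hneg, hhalf]
  ring

/-- The easy half of Szegő's theorem: a weighted `L²` norm of a polynomial with constant
coefficient `1` is at least the geometric mean of the weight. -/
theorem Polynomial.exp_integral_le_integral_norm_eval_sq_mul_exp (P : Polynomial ℂ)
    (hP : P.coeff 0 = 1) {h : ℝ → ℝ} (hh : Continuous h) :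
    Real.exp ((2 * Real.pi)⁻¹ * ∫ θ in Set.Ioc (-Real.pi) Real.pi, h θ) ≤
      (2 * Real.pi)⁻¹ * ∫ θ in Set.Ioc (-Real.pi) Real.pi,
        ‖P.eval (circleMap 0 1 θ)‖ ^ 2 * Real.exp (h θ) := by
  have hP0 : P ≠ 0 := by rintro rfl; simp at hP
  have hπ := Real.pi_pos
  set μ := volume.restrict (Set.Ioc (-Real.pi) Real.pi) with hμ
  have hvol : (volume.real (Set.Ioc (-Real.pi) Real.pi)) = 2 * Real.pi := by
    rw [Real.volume_real_Ioc_of_le (by linarith)]; ring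
  have : NeZero μ := ⟨by
    rw [hμ, Ne, Measure.restrict_eq_zero, Real.volume_Ioc, ENNReal.ofReal_eq_zero]; linarith⟩
  have havg (f : ℝ → ℝ) : ⨍ θ, f θ ∂μ = (2 * Real.pi)⁻¹ * ∫ θ, f θ ∂μ := by
    rw [setAverage_eq, hvol, smul_eq_mul]
  have hint {f : ℝ → ℝ} (hf : Continuous f) : Integrable f μ :=
    hf.integrableOn_Icc.mono_set Set.Ioc_subset_Icc_self
  have hlogint : Integrable (fun θ ↦ Real.log ‖P.eval (circleMap 0 1 θ)‖) μ := by
    have hper : (fun θ ↦ Real.log ‖P.eval (circleMap 0 1 θ)‖).Periodic (2 * Real.pi) :=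
      fun x ↦ by simp [periodic_circleMap 0 1 x]
    exact (hper.intervalIntegrable₀ (by positivity) P.intervalIntegrable_mahlerMeasure
      (-Real.pi) Real.pi).1
  have hlog : 0 ≤ (2 * Real.pi)⁻¹ * ∫ θ, Real.log ‖P.eval (circleMap 0 1 θ)‖ ∂μ := by
    rw [← circleAverage_zero_one_eq_setIntegral fun z ↦ Real.log ‖P.eval z‖,
      ← Polynomial.logMahlerMeasure_def, Polynomial.logMahlerMeasure_eq_log_MahlerMeasure]
    apply Real.log_nonneg
    simpa [hP] using P.norm_coeff_le_choose_mul_mahlerMeasure 0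
  have hae : ∀ᵐ θ ∂μ, Real.exp (2 * Real.log ‖P.eval (circleMap 0 1 θ)‖ + h θ) =
      ‖P.eval (circleMap 0 1 θ)‖ ^ 2 * Real.exp (h θ) := by
    have hcount : (circleMap 0 1 ⁻¹' (P.rootSet ℂ)).Countable :=
      ((P.rootSet_finite ℂ).countable).preimage_circleMap 0 one_ne_zero
    filter_upwards [ae_restrict_of_ae (hcount.ae_notMem volume)] with θ hθ
    have hne : P.eval (circleMap 0 1 θ) ≠ 0 := fun h0 ↦ hθ <| by
      simpa [Polynomial.mem_rootSet, hP0] using h0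
    rw [Real.exp_add, two_mul, Real.exp_add, Real.exp_log (norm_pos_iff.mpr hne), sq]
  have hcont : Continuous fun θ ↦ ‖P.eval (circleMap 0 1 θ)‖ ^ 2 * Real.exp (h θ) := by
    fun_prop
  have key := convexOn_exp.map_average_le (μ := μ)
    (f := fun θ ↦ 2 * Real.log ‖P.eval (circleMap 0 1 θ)‖ + h θ)
    Real.continuousOn_exp isClosed_univ (by simp) ((hlogint.const_mul 2).add (hint hh))
    ((integrable_congr hae).mpr (hint hcont))
  rw [average_congr hae, havg, havg, integral_add (hlogint.const_mul 2) (hint hh),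
    integral_const_mul] at key
  refine le_trans (Real.exp_le_exp.mpr ?_) key
  linarith

/-- Truncating the weight `exp (-β / |θ|)` at scale `1 / (n + 1)` at most doubles the weighted
`L²` norm of a polynomial of degree at most `n`. -/
theorem Polynomial.integral_norm_eval_sq_mul_exp_truncation_le (P : Polynomial ℂ) {n : ℕ}
    (hP : P.natDegree ≤ n) {β : ℝ} (hβ : 0 < β) :
    ∫ θ in Set.Ioc (-Real.pi) Real.pi, ‖P.eval (circleMap 0 1 θ)‖ ^ 2 *
        Real.exp (-β * (max |θ| (n + 1 : ℝ)⁻¹)⁻¹) ≤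
      2 * ∫ θ in Set.Ioc (-Real.pi) Real.pi,
        ‖P.eval (circleMap 0 1 θ)‖ ^ 2 * Real.exp (-β / |θ|) := by
  have hπ := Real.pi_gt_three
  set δ : ℝ := (n + 1 : ℝ)⁻¹ with hδdef
  have hδ : 0 < δ := by positivity
  set μ := volume.restrict (Set.Ioc (-Real.pi) Real.pi) with hμ
  set F : ℝ → ℝ := fun θ ↦ ‖P.eval (circleMap 0 1 θ)‖ ^ 2 with hF
  set E : ℝ := Real.exp (-β * δ⁻¹) with hE
  set S : Set ℝ := Set.Icc (-δ) δ
  have hS : MeasurableSet S := measurableSet_Icc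
  have hF0 (θ : ℝ) : 0 ≤ F θ := by positivity
  have hFc : Continuous F := by fun_prop
  have hint {f : ℝ → ℝ} (hf : Continuous f) : Integrable f μ :=
    hf.integrableOn_Icc.mono_set Set.Ioc_subset_Icc_self
  have hFi := hint hFc
  have hGi : Integrable (S.indicator F) μ := hFi.indicator hS
  have hmax : Continuous fun θ : ℝ ↦ (max |θ| δ)⁻¹ :=
    (by fun_prop : Continuous fun θ : ℝ ↦ max |θ| δ).inv₀
      fun θ ↦ (lt_max_of_lt_right hδ).ne'
  have hvi : Integrable (fun θ ↦ F θ * Real.exp (-β * (max |θ| δ)⁻¹)) μ :=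
    hint (by fun_prop)
  have hwi : Integrable (fun θ ↦ F θ * Real.exp (-β / |θ|)) μ := by
    refine hFi.mul_bdd (c := 1)
      (by fun_prop : Measurable fun θ : ℝ ↦ Real.exp (-β / |θ|)).aestronglyMeasurable (ae_of_all _ fun θ ↦ ?_)
    rw [Real.norm_eq_abs, Real.abs_exp, Real.exp_le_one_iff, neg_div, neg_nonpos]
    positivity
  have hupper : ∫ θ, F θ * Real.exp (-β * (max |θ| δ)⁻¹) ∂μ ≤
      (∫ θ, F θ * Real.exp (-β / |θ|) ∂μ) + E * ∫ θ, S.indicator F θ ∂μ := by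
    rw [← integral_const_mul, ← integral_add hwi (hGi.const_mul E)]
    refine integral_mono hvi (hwi.add (hGi.const_mul E)) fun θ ↦ ?_
    by_cases hθ : θ ∈ S
    · have : |θ| ≤ δ := abs_le.mpr hθ
      simp only [Set.indicator_of_mem hθ, max_eq_right this, ← hE]
      have := mul_nonneg (hF0 θ) (Real.exp_pos (-β / |θ|)).le
      linarith
    · have : δ ≤ |θ| := by
        by_contra hlt
        exact hθ (abs_le.mp (not_le.mp hlt).le)
      simp [Set.indicator_of_notMem hθ, max_eq_left this, div_eq_mul_inv]
  have hlower : E * ((∫ θ, F θ ∂μ) - ∫ θ, S.indicator F θ ∂μ) ≤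
      ∫ θ, F θ * Real.exp (-β / |θ|) ∂μ := by
    rw [← integral_sub hFi hGi, ← integral_const_mul]
    refine integral_mono ((hFi.sub hGi).const_mul E) hwi fun θ ↦ ?_
    by_cases hθ : θ ∈ S
    · simp only [Set.indicator_of_mem hθ, sub_self, mul_zero]
      exact mul_nonneg (hF0 θ) (Real.exp_pos _).le
    · have hle : δ ≤ |θ| := by
        by_contra hlt
        exact hθ (abs_le.mp (not_le.mp hlt).le)
      simp only [Set.indicator_of_notMem hθ, sub_zero]
      rw [mul_comm]
      refine mul_le_mul_of_nonneg_left ?_ (hF0 θ)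
      rw [hE, Real.exp_le_exp, neg_mul, neg_div, neg_le_neg_iff, div_eq_mul_inv]
      gcongr
  have hsmall : ∫ θ, S.indicator F θ ∂μ ≤ (∫ θ, F θ ∂μ) / 2 := by
    set I := ∫ θ, F θ ∂μ with hI
    have hI0 : 0 ≤ I := integral_nonneg hF0
    have hbound (θ : ℝ) : F θ ≤ (n + 1) * ((2 * Real.pi)⁻¹ * I) := by
      have := P.norm_eval_sq_le_circleAverage hP (z := circleMap 0 1 θ) (by simp)
      rwa [circleAverage_zero_one_eq_setIntegral fun z ↦ ‖P.eval z‖ ^ 2] at this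
    have hvol : volume.real S = 2 * δ := by
      rw [Real.volume_real_Icc_of_le (by linarith)]; ring
    calc ∫ θ, S.indicator F θ ∂μ ≤ ∫ θ, S.indicator F θ :=
          setIntegral_le_integral (hFc.integrableOn_Icc.integrable_indicator hS)
            (ae_of_all _ (Set.indicator_nonneg fun θ _ ↦ hF0 θ))
      _ = ∫ θ in S, F θ := integral_indicator hS
      _ ≤ ∫ θ in S, (n + 1) * ((2 * Real.pi)⁻¹ * I) :=
          integral_mono hFc.integrableOn_Icc (integrable_const _) hbound
      _ = Real.pi⁻¹ * I := by
          rw [setIntegral_const, hvol, smul_eq_mul, hδdef]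
          field_simp
      _ ≤ I / 2 := by
          rw [div_eq_inv_mul]
          gcongr
          linarith
  have hEG : E * ∫ θ, S.indicator F θ ∂μ ≤
      E * ((∫ θ, F θ ∂μ) - ∫ θ, S.indicator F θ ∂μ) :=
    mul_le_mul_of_nonneg_left (by linarith) (Real.exp_pos _).le
  linarith

/-- Integrals against the weight `c exp (-β / |arg z|)` on the circle in angular coordinates. -/
theorem integral_mCircle_withDensity (c β : ℝ) (hc : 0 < c) {f : ℂ → ℝ} (hf : Continuous f) :
    ∫ z, f z ∂mCircle.withDensity
        (fun z ↦ ENNReal.ofReal (c * Real.exp (-β / |Complex.arg z|))) =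
      c * ((2 * Real.pi)⁻¹ * ∫ θ in Set.Ioc (-Real.pi) Real.pi,
        f (circleMap 0 1 θ) * Real.exp (-β / |θ|)) := by
  have hmeas : Measurable fun z : ℂ ↦ c * Real.exp (-β / |Complex.arg z|) := by fun_prop
  rw [integral_withDensity_eq_integral_toReal_smul hmeas.ennreal_ofReal
    (ae_of_all _ fun z ↦ ENNReal.ofReal_lt_top)]
  unfold mCircle
  have hprod : Measurable fun z ↦
      (ENNReal.ofReal (c * Real.exp (-β / |Complex.arg z|))).toReal • f z :=
    hmeas.ennreal_ofReal.ennreal_toReal.smul hf.measurable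
  rw [integral_map (by fun_prop) hprod.aestronglyMeasurable,
    integral_smul_measure, ENNReal.toReal_inv, ENNReal.toReal_ofReal (by positivity),
    smul_eq_mul, mul_left_comm, ← integral_const_mul c]
  congr 1
  refine setIntegral_congr_fun measurableSet_Ioc fun θ hθ ↦ ?_
  simp only [Complex.arg_exp_mul_I, (toIocMod_eq_self Real.two_pi_pos).mpr
    (show θ ∈ Set.Ioc (-Real.pi) (-Real.pi + 2 * Real.pi) by
      rwa [show -Real.pi + 2 * Real.pi = Real.pi by ring])]
  rw [ENNReal.toReal_ofReal (by positivity), circleMap_zero, Complex.ofReal_one, one_mul,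
    smul_eq_mul]
  ring

/-- A continuous function is integrable against a finite measure carried by the unit circle. -/
theorem Continuous.integrable_of_norm_eq_one_ae (ρ : Measure ℂ) [IsFiniteMeasure ρ]
    (hcirc : ρ {z : ℂ | ‖z‖ ≠ 1} = 0) {f : ℂ → ℝ} (hf : Continuous f) : Integrable f ρ := by
  obtain ⟨C, hC⟩ := (isCompact_sphere (0 : ℂ) 1).exists_bound_of_continuousOn hf.continuousOn
  refine Integrable.of_bound hf.aestronglyMeasurable C ?_
  have hae : ∀ᵐ z ∂ρ, ‖z‖ = 1 := hcirc
  filter_upwards [hae] with z hz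
  exact hC z (by simpa using hz)

/-- If `ρ` is a measure on the unit circle with
`dρ(e^{iθ}) ≥ c exp(-β/|θ|) dm(θ)` (here `θ = arg z ∈ (-π, π]`), then
`e_n(ρ) ≥ c_β n^{-β/(2π)}` for some `c_β > 0` and all `n ≥ 1`; in particular
`Σ_n e_n(ρ)² = ∞` when `β ≤ π`. -/
theorem stmt14 (ρ : Measure ℂ) [IsFiniteMeasure ρ]
    (hcirc : ρ {z : ℂ | ‖z‖ ≠ 1} = 0)
    (c β : ℝ) (hc : 0 < c) (hβ : 0 < β)
    (hlow : ∀ s : Set ℂ, MeasurableSet s →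
      (∫⁻ z in s, ENNReal.ofReal (c * Real.exp (-β / |Complex.arg z|)) ∂mCircle)
        ≤ ρ s) :
    (∃ cβ > (0 : ℝ), ∀ n : ℕ, 1 ≤ n →
      cβ * (n : ℝ) ^ (-(β / (2 * Real.pi))) ≤ eN ρ n) ∧
    (β ≤ Real.pi → ¬ Summable fun n : ℕ => eN ρ n ^ 2) := by
  have hπ := Real.pi_gt_three
  set K : ℝ := (c / 2) * (2 * Real.exp 1 * Real.pi) ^ (-(β / Real.pi)) with hK
  have hK0 : 0 < K := by positivity
  have hpoly (n : ℕ) (hn : 1 ≤ n) (Q : Polynomial ℂ) (hQ : Q.natDegree ≤ n)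
      (hQ0 : Q.eval 0 = 0) :
      K * (n : ℝ) ^ (-(β / Real.pi)) ≤ ∫ z, ‖(1 : ℂ) - Q.eval z‖ ^ 2 ∂ρ := by
    have hn1 : (1 : ℝ) ≤ n := by exact_mod_cast hn
    set P : Polynomial ℂ := 1 - Q with hPdef
    have hPeval (z : ℂ) : (1 : ℂ) - Q.eval z = P.eval z := by simp [hPdef]
    have hP0 : P.coeff 0 = 1 := by
      rw [Polynomial.coeff_zero_eq_eval_zero, ← hPeval, hQ0, sub_zero]
    have hPdeg : P.natDegree ≤ n :=
      (Polynomial.natDegree_sub_le 1 Q).trans (by simpa using hQ)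
    have hcontP : Continuous fun z ↦ ‖P.eval z‖ ^ 2 := by fun_prop
    simp_rw [hPeval]
    set δ : ℝ := (n + 1 : ℝ)⁻¹ with hδdef
    have hδ : 0 < δ := by positivity
    have hδ1 : δ ≤ 1 := inv_le_one_of_one_le₀ (by linarith)
    have hmax : Continuous fun θ : ℝ ↦ (max |θ| δ)⁻¹ :=
      (by fun_prop : Continuous fun θ : ℝ ↦ max |θ| δ).inv₀
        fun θ ↦ (lt_max_of_lt_right hδ).ne'
    have hjensen := P.exp_integral_le_integral_norm_eval_sq_mul_exp hP0
      (h := fun θ ↦ -β * (max |θ| δ)⁻¹) (by fun_prop)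
    rw [integral_const_mul, integral_inv_max_abs hδ (by linarith)] at hjensen
    have htrunc := P.integral_norm_eval_sq_mul_exp_truncation_le hPdeg hβ
    have hmono := integral_mono_measure
      (Measure.le_iff.mpr fun s hs ↦ by rw [withDensity_apply _ hs]; exact hlow s hs)
      (ae_of_all ρ fun z ↦ sq_nonneg ‖P.eval z‖)
      (hcontP.integrable_of_norm_eq_one_ae ρ hcirc)
    rw [integral_mCircle_withDensity c β hc hcontP] at hmono
    have hrpow : (2 * Real.exp 1 * Real.pi) ^ (-(β / Real.pi)) * (n : ℝ) ^ (-(β / Real.pi)) ≤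
        Real.exp ((2 * Real.pi)⁻¹ * (-β * (2 * (1 + Real.log (Real.pi / δ))))) := by
      rw [← Real.mul_rpow (by positivity) (by positivity),
        Real.rpow_def_of_pos (by positivity), Real.exp_le_exp]
      have hlog : 1 + Real.log (Real.pi / δ) ≤ Real.log (2 * Real.exp 1 * Real.pi * n) := by
        have hexp : 1 + Real.log (Real.pi / δ) = Real.log (Real.exp 1 * (Real.pi / δ)) := by
          rw [Real.log_mul (Real.exp_pos 1).ne' (by positivity), Real.log_exp]
        rw [hexp]
        apply Real.log_le_log (by positivity)
        rw [hδdef, div_inv_eq_mul]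
        have : (n : ℝ) + 1 ≤ 2 * n := by linarith
        calc Real.exp 1 * (Real.pi * (n + 1)) ≤ Real.exp 1 * (Real.pi * (2 * n)) := by gcongr
          _ = _ := by ring
      have heq : (2 * Real.pi)⁻¹ * (-β * (2 * (1 + Real.log (Real.pi / δ)))) =
          -((1 + Real.log (Real.pi / δ)) * (β / Real.pi)) := by
        field_simp
      rw [heq, mul_neg, neg_le_neg_iff]
      gcongr
    refine le_trans ?_ hmono
    have hchain := hrpow.trans (hjensen.trans
      (mul_le_mul_of_nonneg_left htrunc (by positivity : 0 ≤ (2 * Real.pi)⁻¹)))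
    have := mul_le_mul_of_nonneg_left hchain (by positivity : 0 ≤ c / 2)
    rw [hK]
    linarith
  have hbound (n : ℕ) (hn : 1 ≤ n) :
      K ^ (1 / 2 : ℝ) * (n : ℝ) ^ (-(β / (2 * Real.pi))) ≤ eN ρ n := by
    refine le_csInf ⟨_, 0, by simp, by simp, rfl⟩ ?_
    rintro r ⟨Q, hQ, hQ0, rfl⟩
    have hexp : -(β / (2 * Real.pi)) = -(β / Real.pi) * (1 / 2) := by field_simp
    rw [hexp, Real.rpow_mul (by positivity), ← Real.mul_rpow hK0.le (by positivity)]
    exact Real.rpow_le_rpow (by positivity) (hpoly n hn Q hQ hQ0) (by norm_num)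
  refine ⟨⟨K ^ (1 / 2 : ℝ), by positivity, hbound⟩, fun hβπ hsum ↦ ?_⟩
  refine Real.not_summable_one_div_natCast ?_
  have hsumK : Summable fun n : ℕ ↦ K⁻¹ * eN ρ n ^ 2 := hsum.mul_left _
  refine Summable.of_nonneg_of_le (fun n ↦ by positivity) (fun n ↦ ?_) hsumK
  rcases Nat.eq_zero_or_pos n with rfl | hn
  · simp only [Nat.cast_zero, div_zero]
    positivity
  have hn1 : (1 : ℝ) ≤ n := by exact_mod_cast hn
  have hsq : K * (n : ℝ) ^ (-(β / Real.pi)) ≤ eN ρ n ^ 2 := by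
    have h := pow_le_pow_left₀ (by positivity) (hbound n hn) 2
    rw [mul_pow, ← Real.rpow_mul_natCast hK0.le, ← Real.rpow_mul_natCast (by positivity)] at h
    have hexp : -(β / (2 * Real.pi)) * (2 : ℕ) = -(β / Real.pi) := by
      push_cast
      field_simp
    rwa [hexp, show (1 / 2 : ℝ) * (2 : ℕ) = 1 by norm_num, Real.rpow_one] at h
  have hpow : 1 / (n : ℝ) ≤ (n : ℝ) ^ (-(β / Real.pi)) := by
    rw [one_div, ← Real.rpow_neg_one]
    apply Real.rpow_le_rpow_of_exponent_le hn1
    rw [neg_le_neg_iff, div_le_one Real.pi_pos]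
    exact hβπ
  rw [le_inv_mul_iff₀ hK0]
  exact (mul_le_mul_of_nonneg_left hpow hK0.le).trans hsq
end

section
/- Let ξ : ℤ → 𝕋 be a two-sided unimodular sequence (|ξ(n)| = 1 for all n) such that the Fourier–Carleman transform F_ξ, defined by F_ξ(z) = Σ_{n≥0} ξ(n) zⁿ for |z| < 1 and F_ξ(z) = −Σ_{n≤−1} ξ(n) zⁿ for |z| > 1, extends analytically across the complement of an arc J ⊂ 𝕋 of length less than π. Then there exist t, s ∈ 𝕋 with ξ(n) = t·sⁿ for all n ∈ ℤ. -/
theorem exp_abs_div_four_le_norm_sin {z : ℂ} (hz : 1 ≤ |z.im|) :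
    Real.exp |z.im| / 4 ≤ ‖Complex.sin z‖ := by
  have h1 : ‖Complex.sin z‖ = ‖Complex.exp (-z * Complex.I) - Complex.exp (z * Complex.I)‖ / 2 := by
    simp [Complex.sin]
  have h2 := abs_norm_sub_norm_le (Complex.exp (-z * Complex.I)) (Complex.exp (z * Complex.I))
  have h3 : Real.exp (-|z.im|) ≤ Real.exp |z.im| / 2 := by
    have : Real.exp (-|z.im|) * 2 ≤ Real.exp (-|z.im|) * Real.exp (2 * |z.im|) := by
      gcongr
      linarith [Real.add_one_le_exp (2 * |z.im|)]
    rw [← Real.exp_add, show -|z.im| + 2 * |z.im| = |z.im| by ring] at this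
    linarith
  rw [h1]
  rw [Complex.norm_exp, Complex.norm_exp] at h2
  simp only [Complex.mul_re, Complex.neg_re, Complex.neg_im, Complex.I_re, Complex.I_im,
    mul_zero, mul_one, zero_sub, neg_neg] at h2
  rcases abs_cases z.im with ⟨h, _⟩ | ⟨h, _⟩ <;> rw [h] at h3 ⊢
  · have := (le_abs_self _).trans h2
    linarith
  · have := (neg_le_abs _).trans h2
    rw [neg_neg] at h3
    linarith

theorem one_le_norm_sin_pi_mul {z : ℂ} {n : ℤ} (hz : z.re = n + 1 / 2) :
    1 ≤ ‖Complex.sin (Real.pi * z)‖ := by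
  have h1 : (Real.pi : ℂ) * z = ((Real.pi * z.im : ℝ) : ℂ) * Complex.I
      + (Real.pi / 2 : ℂ) + n * Real.pi := by
    conv_lhs => rw [← Complex.re_add_im z, hz]
    push_cast
    ring
  rw [h1, Complex.sin_antiperiodic.add_int_mul_eq, Complex.sin_add_pi_div_two, Complex.cos_mul_I,
    ← Complex.ofReal_cosh, norm_mul, Int.coe_negOnePow, norm_pow, norm_neg, norm_one, one_pow, one_mul,
    Complex.norm_real, Real.norm_eq_abs]
  exact (Real.one_le_cosh _).trans (le_abs_self _)

/-- An entire function of exponential type which is bounded on both coordinate axes is bounded. -/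
theorem Complex.norm_le_of_axes_of_norm_le_exp {f : ℂ → ℂ} (hf : Differentiable ℂ f)
    {C B M : ℝ} (hexp : ∀ z, ‖f z‖ ≤ C * Real.exp (B * ‖z‖))
    (hre : ∀ x : ℝ, ‖f x‖ ≤ M) (him : ∀ x : ℝ, ‖f (x * Complex.I)‖ ≤ M) (z : ℂ) :
    ‖f z‖ ≤ M := by
  have hB (s : Set ℂ) : ∃ c < (2 : ℝ), ∃ B,
      f =O[Bornology.cobounded ℂ ⊓ Filter.principal s] fun z => Real.exp (B * ‖z‖ ^ c) := by
    refine ⟨1, by norm_num, B, Asymptotics.IsBigO.of_bound C (Filter.Eventually.of_forall ?_)⟩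
    intro w
    simpa using hexp w
  rcases le_total 0 z.re with h1 | h1 <;> rcases le_total 0 z.im with h2 | h2
  · exact PhragmenLindelof.quadrant_I hf.diffContOnCl (hB _) (fun x _ => hre x)
      (fun x _ => him x) h1 h2
  · exact PhragmenLindelof.quadrant_IV hf.diffContOnCl (hB _) (fun x _ => hre x)
      (fun x _ => him x) h1 h2
  · exact PhragmenLindelof.quadrant_II hf.diffContOnCl (hB _) (fun x _ => hre x)
      (fun x _ => him x) h1 h2
  · exact PhragmenLindelof.quadrant_III hf.diffContOnCl (hB _) (fun x _ => hre x)
      (fun x _ => him x) h1 h2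

/-- An entire function vanishing at the integers is divisible by `sin (π z)`. -/
theorem Complex.exists_eq_mul_sin_pi_mul {h : ℂ → ℂ} (hh : Differentiable ℂ h)
    (hz : ∀ n : ℤ, h n = 0) :
    ∃ q : ℂ → ℂ, Differentiable ℂ q ∧ ∀ z, h z = q z * Complex.sin (Real.pi * z) := by
  set S : ℂ → ℂ := fun z => Complex.sin (Real.pi * z) with hS
  have hSd : Differentiable ℂ S := by fun_prop
  have hSz (z : ℂ) : S z = 0 ↔ ∃ n : ℤ, z = n := by
    simp only [hS, Complex.sin_eq_zero_iff]
    refine exists_congr fun n => ?_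
    rw [mul_comm]
    exact mul_left_inj' (by exact_mod_cast Real.pi_ne_zero)
  have hSder (n : ℤ) : deriv S n ≠ 0 := by
    have : HasDerivAt S (Complex.cos (Real.pi * n) * (Real.pi * 1)) (n : ℂ) :=
      ((hasDerivAt_id (n : ℂ)).const_mul (Real.pi : ℂ)).csin
    rw [this.deriv]
    refine mul_ne_zero ?_ (by simp [Real.pi_ne_zero])
    intro h0
    have h1 := Complex.sin_sq_add_cos_sq ((Real.pi : ℂ) * n)
    have h2 : Complex.sin (Real.pi * n) = 0 := (hSz n).2 ⟨n, rfl⟩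
    simp [h0, h2] at h1
  classical
  refine ⟨fun z => if S z = 0 then deriv h z / deriv S z else h z / S z, ?_, ?_⟩
  · intro z
    by_cases h0 : S z = 0
    · obtain ⟨n, rfl⟩ := (hSz z).1 h0
      have hd1 : DifferentiableAt ℂ (dslope h n) (n : ℂ) :=
        ((Complex.differentiableOn_dslope Filter.univ_mem).2 hh.differentiableOn).differentiableAt
          Filter.univ_mem
      have hd2 : DifferentiableAt ℂ (dslope S n) (n : ℂ) :=
        ((Complex.differentiableOn_dslope Filter.univ_mem).2 hSd.differentiableOn).differentiableAt
          Filter.univ_mem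
      have hne : dslope S n n ≠ 0 := by rw [dslope_same]; exact hSder n
      refine (hd1.div hd2 hne).congr_of_eventuallyEq ?_
      filter_upwards [hd2.continuousAt.eventually_ne hne] with w hw
      by_cases hwn : w = n
      · subst hwn
        simp [h0]
      · have e1 : dslope S n w = (w - n)⁻¹ * S w := by
          rw [dslope_of_ne _ hwn, slope_def_module, h0, sub_zero, smul_eq_mul]
        have e2 : dslope h n w = (w - n)⁻¹ * h w := by
          rw [dslope_of_ne _ hwn, slope_def_module, hz n, sub_zero, smul_eq_mul]
        have hSw : S w ≠ 0 := by
          rintro h3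
          exact hw (by rw [e1, h3, mul_zero])
        have : (w - n)⁻¹ ≠ 0 := inv_ne_zero (sub_ne_zero.2 hwn)
        simp only [hSw, if_false, Pi.div_apply, e1, e2]
        rw [mul_div_mul_left _ _ this]
    · refine ((hh z).div (hSd z) h0).congr_of_eventuallyEq ?_
      filter_upwards [(hSd z).continuousAt.eventually_ne h0] with w hw
      simp [hw]
  · intro z
    by_cases h0 : S z = 0
    · obtain ⟨n, rfl⟩ := (hSz z).1 h0
      rw [hz n, show Complex.sin (Real.pi * n) = 0 from h0, mul_zero]
    · simp only [h0, if_false]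
      exact (div_mul_cancel₀ _ h0).symm

/-- **Carlson's theorem**, for functions vanishing at all integers. -/
theorem Complex.eq_zero_of_forall_int_eq_zero {h : ℂ → ℂ} (hh : Differentiable ℂ h)
    {C a b : ℝ} (ha : 0 ≤ a) (hb : 0 ≤ b) (hab : a + b < Real.pi)
    (hbd : ∀ z, ‖h z‖ ≤ C * Real.exp (a * |z.re| + b * |z.im|))
    (hz : ∀ n : ℤ, h n = 0) (z : ℂ) : h z = 0 := by
  obtain ⟨q, hq, hqS⟩ := Complex.exists_eq_mul_sin_pi_mul hh hz
  have hC : 0 ≤ C := by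
    have := (norm_nonneg _).trans (hbd 0)
    simpa using this
  have hpi := Real.pi_gt_three
  have him (w : ℂ) : |((Real.pi : ℂ) * w).im| = Real.pi * |w.im| := by
    simp [abs_mul, abs_of_pos Real.pi_pos]
  have hfar (w : ℂ) (hw : 1 ≤ |w.im|) :
      ‖q w‖ ≤ 4 * C * Real.exp (a * |w.re| + b * |w.im| - Real.pi * |w.im|) := by
    have h1 := exp_abs_div_four_le_norm_sin (z := Real.pi * w) (by rw [him]; nlinarith)
    have h2 := hbd w
    rw [hqS w, norm_mul] at h2
    rw [him] at h1
    have h3 := mul_le_mul_of_nonneg_left h1 (norm_nonneg (q w))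
    rw [Real.exp_sub, mul_div_assoc', le_div_iff₀ (Real.exp_pos _)]
    linarith
  have hone {w : ℂ} (h1 : 1 ≤ ‖Complex.sin (Real.pi * w)‖) : ‖q w‖ ≤ ‖h w‖ := by
    rw [hqS w, norm_mul]
    exact le_mul_of_one_le_right (norm_nonneg _) h1
  have hnear (w : ℂ) (hw : |w.im| < 1) : ‖q w‖ ≤ C * Real.exp (a * (|w.re| + 1) + b) := by
    set n : ℤ := ⌊w.re + 1 / 2⌋ with hn
    have hn1 : (n : ℝ) ≤ w.re + 1 / 2 := Int.floor_le _
    have hn2 : w.re + 1 / 2 < n + 1 := Int.lt_floor_add_one _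
    set U : Set ℂ := Set.Ioo ((n : ℝ) - 1 / 2) (n + 1 / 2) ×ℂ Set.Ioo (-1) 1 with hU
    have hcl : closure U = Set.Icc ((n : ℝ) - 1 / 2) (n + 1 / 2) ×ℂ Set.Icc (-1) 1 := by
      rw [hU, Complex.closure_reProdIm, closure_Ioo (by linarith), closure_Ioo (by norm_num)]
    have hUb : Bornology.IsBounded U :=
      (Metric.isBounded_Ioo _ _).reProdIm (Metric.isBounded_Ioo _ _)
    refine Complex.norm_le_of_forall_mem_frontier_norm_le hUb hq.diffContOnCl (fun v hv => ?_)
      (z := w) ?_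
    · have hvc : v ∈ closure U := frontier_subset_closure hv
      rw [hcl, Complex.mem_reProdIm] at hvc
      obtain ⟨⟨hv1, hv2⟩, hv3, hv4⟩ := hvc
      have hsin : 1 ≤ ‖Complex.sin (Real.pi * v)‖ := by
        have hv' : v ∉ U := by
          have : IsOpen U := isOpen_Ioo.reProdIm isOpen_Ioo
          exact fun hvU => (this.frontier_eq ▸ hv).2 hvU
        rw [hU, Complex.mem_reProdIm] at hv'
        by_cases hr : v.re ∈ Set.Ioo ((n : ℝ) - 1 / 2) (n + 1 / 2)
        · have hi : 1 ≤ |v.im| := by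
            by_contra hlt
            exact hv' ⟨hr, abs_lt.1 (not_le.1 hlt)⟩
          have h1 := exp_abs_div_four_le_norm_sin (z := Real.pi * v) (by rw [him]; nlinarith)
          have h2 := Real.add_one_le_exp |((Real.pi : ℂ) * v).im|
          rw [him] at h1 h2
          nlinarith
        · rw [Set.mem_Ioo, not_and_or, not_lt, not_lt] at hr
          rcases hr with hr | hr
          · refine one_le_norm_sin_pi_mul (n := n - 1) ?_
            push_cast
            linarith
          · refine one_le_norm_sin_pi_mul (n := n) ?_
            linarith
      refine (hone hsin).trans ((hbd v).trans ?_)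
      have e1 : |v.re| ≤ |w.re| + 1 := by
        have : |v.re - w.re| ≤ 1 := abs_le.2 ⟨by linarith, by linarith⟩
        linarith [abs_sub_abs_le_abs_sub v.re w.re]
      have e2 : |v.im| ≤ 1 := abs_le.2 ⟨hv3, hv4⟩
      gcongr
      nlinarith
    · rw [hcl, Complex.mem_reProdIm]
      exact ⟨⟨by linarith, by linarith⟩, (abs_lt.1 hw).1.le, (abs_lt.1 hw).2.le⟩
  have hglob (w : ℂ) : ‖q w‖ ≤ 4 * C * Real.exp (a + b) * Real.exp ((a + b) * ‖w‖) := by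
    rw [mul_assoc, ← Real.exp_add]
    have e1 := Complex.abs_re_le_norm w
    have e2 := Complex.abs_im_le_norm w
    have e3 := abs_nonneg w.im
    rcases le_or_gt 1 |w.im| with hw | hw
    · refine (hfar w hw).trans ?_
      gcongr
      nlinarith
    · refine (hnear w hw).trans ?_
      have : C ≤ 4 * C := by linarith
      have h2 : a * (|w.re| + 1) + b ≤ a + b + (a + b) * ‖w‖ := by
        nlinarith [norm_nonneg w, mul_nonneg hb (norm_nonneg w)]
      gcongr
  have hdiag (w : ℂ) (hw : |w.re| = |w.im|) :
      ‖q w‖ ≤ 4 * C * Real.exp (a + b) * Real.exp ((a + b) * 2) := by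
    rcases le_or_gt 1 |w.im| with h1 | h1
    · refine (hfar w h1).trans ?_
      rw [mul_assoc (4 * C), ← Real.exp_add, hw]
      gcongr
      nlinarith
    · refine (hglob w).trans ?_
      gcongr
      linarith [Complex.norm_le_abs_re_add_abs_im w]
  have hbdd (w : ℂ) : ‖q w‖ ≤ 4 * C * Real.exp (a + b) * Real.exp ((a + b) * 2) := by
    have hne : (1 + Complex.I) ≠ 0 := by
      intro h0
      simpa using congrArg Complex.re h0
    have := Complex.norm_le_of_axes_of_norm_le_exp
      (f := fun w => q ((1 + Complex.I) * w)) (by fun_prop)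
      (C := 4 * C * Real.exp (a + b)) (B := (a + b) * ‖1 + Complex.I‖)
      (fun w => by
        have := hglob ((1 + Complex.I) * w)
        rwa [norm_mul, ← mul_assoc] at this)
      (fun x => hdiag _ (by simp)) (fun x => hdiag _ (by simp)) (w / (1 + Complex.I))
    simpa [mul_div_cancel₀ _ hne] using this
  have hconst (w : ℂ) : q w = q 0 := by
    apply hq.apply_eq_apply_of_bounded
    rw [isBounded_iff_forall_norm_le]
    exact ⟨_, by rintro _ ⟨w, rfl⟩; exact hbdd w⟩
  have hlim : Filter.Tendsto (fun x : ℝ => 4 * C * Real.exp (-((Real.pi - (a + b)) * x)))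
      Filter.atTop (nhds (4 * C * 0)) := by
    refine Filter.Tendsto.const_mul _ (Real.tendsto_exp_neg_atTop_nhds_zero.comp ?_)
    exact Filter.tendsto_id.const_mul_atTop (by linarith)
  have hq0 : ‖q 0‖ ≤ 4 * C * 0 := by
    refine ge_of_tendsto hlim ?_
    filter_upwards [Filter.eventually_ge_atTop 1] with x hx
    have := hfar ((x : ℂ) + x * Complex.I) (by simp [abs_of_pos (by linarith : (0 : ℝ) < x), hx])
    rw [hconst] at this
    refine this.trans (le_of_eq ?_)
    simp only [Complex.add_re, Complex.ofReal_re, Complex.mul_re, Complex.I_re, mul_zero,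
      Complex.ofReal_im, Complex.I_im, mul_one, sub_self, add_zero, Complex.add_im,
      Complex.mul_im, zero_add, abs_of_pos (by linarith : (0 : ℝ) < x)]
    ring_nf
  rw [hqS z, hconst, norm_le_zero_iff.1 (hq0.trans_eq (mul_zero _)), zero_mul]

/-- A nowhere vanishing entire function of exponential type is an exponential. -/
theorem Complex.eq_exp_of_ne_zero_of_norm_le_exp {f : ℂ → ℂ} (hf : Differentiable ℂ f)
    (hne : ∀ z, f z ≠ 0) {C B : ℝ} (hexp : ∀ z, ‖f z‖ ≤ C * Real.exp (B * ‖z‖)) :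
    ∃ α β : ℂ, ∀ z, f z = Complex.exp (α * z + β) := by
  have hfd : Differentiable ℂ (deriv f) :=
    (hf.contDiff (n := 2)).differentiable_deriv_two
  obtain ⟨g, hg⟩ := (hfd.div hf hne).isExactOn_univ.with_val_at 0 (Complex.log (f 0))
  obtain ⟨hg0, hg⟩ := hg
  replace hg : ∀ x, HasDerivAt g (deriv f x / f x) x := fun x => hg x (Set.mem_univ _)
  have hgd : Differentiable ℂ g := fun x => (hg x).differentiableAt
  have hfg (z : ℂ) : f z = Complex.exp (g z) := by
    have hd (x : ℂ) : HasDerivAt (fun x => f x * Complex.exp (-g x)) 0 x := by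
      have := (hf x).hasDerivAt.mul (hg x).neg.cexp
      refine this.congr_deriv ?_
      field_simp [hne x]
      simp
    have h1 : f z * Complex.exp (-g z) = f 0 * Complex.exp (-g 0) :=
      is_const_of_deriv_eq_zero (fun x => (hd x).differentiableAt) (fun x => (hd x).deriv) z 0
    rw [hg0, Complex.exp_neg, Complex.exp_neg, Complex.exp_log (hne 0),
      mul_inv_cancel₀ (hne 0)] at h1
    field_simp at h1
    exact h1
  set K : ℝ := |Real.log C| + |B| + 1 with hK
  have hKpos : 0 < K := by positivity
  have hCpos : 0 < C := by
    have := (norm_pos_iff.2 (hne 0)).trans_le (hexp 0)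
    simpa using this
  have hre (z : ℂ) : (g z).re ≤ K * (1 + ‖z‖) := by
    have h1 := hexp z
    rw [hfg z, Complex.norm_exp] at h1
    have h2 : (g z).re ≤ Real.log C + B * ‖z‖ := by
      rw [← Real.exp_le_exp, Real.exp_add, Real.exp_log hCpos]
      exact h1
    have h3 := le_abs_self (Real.log C)
    have h4 := le_abs_self B
    have h5 := abs_nonneg (Real.log C)
    have h6 := abs_nonneg B
    nlinarith [norm_nonneg z]
  have hbd (z : ℂ) : ‖g z‖ ≤ 4 * K * ‖z‖ + 3 * ‖g 0‖ := by
    set R : ℝ := 2 * ‖z‖ + 1 with hR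
    have hz := norm_nonneg z
    have h1 := Complex.borelCaratheodory (f := g) (M := K * (1 + R)) (R := R) (z := z)
      (by positivity) hgd.differentiableOn (fun w hw => (hre w).trans (by
        have := mem_ball_zero_iff.1 hw
        gcongr)) (by positivity) (by simp [hR]; linarith)
    refine h1.trans ?_
    have h2 : R - ‖z‖ = ‖z‖ + 1 := by rw [hR]; ring
    rw [h2, ← add_div, div_le_iff₀ (by positivity)]
    rw [hR]
    nlinarith [norm_nonneg (g 0)]
  have hderiv (z : ℂ) : ‖deriv g z‖ ≤ 8 * K + 3 * ‖g 0‖ := by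
    have hz := norm_nonneg z
    have h1 := Complex.norm_deriv_le_of_forall_mem_sphere_norm_le (f := g) (c := z)
      (R := ‖z‖ + 1) (C := (8 * K + 3 * ‖g 0‖) * (‖z‖ + 1)) (by positivity) hgd.diffContOnCl
      (fun w hw => by
        have hw' : ‖w‖ ≤ 2 * ‖z‖ + 1 := by
          have := norm_le_norm_add_norm_sub' w z
          rw [mem_sphere_iff_norm] at hw
          linarith
        refine (hbd w).trans ?_
        nlinarith [norm_nonneg (g 0), mul_nonneg (norm_nonneg (g 0)) hz])
    rwa [mul_div_cancel_right₀ _ (by positivity)] at h1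
  have hgdd : Differentiable ℂ (deriv g) :=
    (hgd.contDiff (n := 2)).differentiable_deriv_two
  have hconst (z : ℂ) : deriv g z = deriv g 0 := by
    apply hgdd.apply_eq_apply_of_bounded
    rw [isBounded_iff_forall_norm_le]
    exact ⟨_, by rintro _ ⟨w, rfl⟩; exact hderiv w⟩
  refine ⟨deriv g 0, g 0, fun z => ?_⟩
  rw [hfg z]
  congr 1
  have hd (x : ℂ) : HasDerivAt (fun x => g x - deriv g 0 * x) 0 x := by
    have := (hgd x).hasDerivAt.sub ((hasDerivAt_id x).const_mul (deriv g 0))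
    refine this.congr_deriv ?_
    rw [hconst]
    simp
  have h1 : g z - deriv g 0 * z = g 0 - deriv g 0 * 0 :=
    is_const_of_deriv_eq_zero (fun x => (hd x).differentiableAt) (fun x => (hd x).deriv) z 0
  linear_combination h1

/-- An entire function of small exponential type which is unimodular at the integers is an
exponential. -/
theorem Complex.eq_exp_of_forall_int_norm_eq_one {f : ℂ → ℂ} (hf : Differentiable ℂ f)
    {C a b : ℝ} (ha : 0 ≤ a) (hb : 0 ≤ b) (hab : 2 * (a + b) < Real.pi)
    (hbd : ∀ z, ‖f z‖ ≤ C * Real.exp (a * |z.re| + b * |z.im|))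
    (hz : ∀ n : ℤ, ‖f n‖ = 1) : ∃ α β : ℂ, ∀ z, f z = Complex.exp (α * z + β) := by
  have hC : 0 ≤ C := by
    have := (norm_nonneg _).trans (hbd 0)
    simpa using this
  set fs : ℂ → ℂ := star ∘ f ∘ star with hfs
  have hfsd : Differentiable ℂ fs := fun z => by
    have := (hf (star z)).star_star
    rwa [star_star] at this
  have hone (z : ℂ) : f z * fs z - 1 = 0 := by
    refine Complex.eq_zero_of_forall_int_eq_zero (h := fun z => f z * fs z - 1)
      (C := C ^ 2 + 1) (a := 2 * a) (b := 2 * b) (by fun_prop)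
      (by positivity) (by positivity) (by linarith) (fun z => ?_) (fun n => ?_) z
    · have h1 := hbd z
      have h2 : ‖fs z‖ ≤ C * Real.exp (a * |z.re| + b * |z.im|) := by
        have := hbd (star z)
        simpa [hfs] using this
      have h3 : 1 ≤ Real.exp (2 * a * |z.re| + 2 * b * |z.im|) :=
        Real.one_le_exp (by positivity)
      calc ‖f z * fs z - 1‖ ≤ ‖f z‖ * ‖fs z‖ + 1 := by
            refine (norm_sub_le _ _).trans ?_
            rw [norm_mul, norm_one]
        _ ≤ (C * Real.exp (a * |z.re| + b * |z.im|)) * (C * Real.exp (a * |z.re| + b * |z.im|))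
            + 1 := by gcongr
        _ = C ^ 2 * Real.exp (2 * a * |z.re| + 2 * b * |z.im|) + 1 := by
            rw [show 2 * a * |z.re| + 2 * b * |z.im|
              = (a * |z.re| + b * |z.im|) + (a * |z.re| + b * |z.im|) by ring,
              Real.exp_add (a * |z.re| + b * |z.im|)]
            ring
        _ ≤ _ := by linarith
    · have : star (n : ℂ) = n := by simp
      simp only [hfs, Function.comp_apply, this]
      rw [Complex.star_def, Complex.mul_conj, Complex.normSq_eq_norm_sq, hz n]
      simp
  refine Complex.eq_exp_of_ne_zero_of_norm_le_exp hf (fun z h0 => ?_) (C := C) (B := a + b) (fun z => ?_)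
  · have := hone z
    simp [h0] at this
  · refine (hbd z).trans ?_
    rw [add_mul]
    gcongr
    · exact Complex.abs_re_le_norm z
    · exact Complex.abs_im_le_norm z

/-- `HasExpType a b f`: the function `f` is entire and `‖f z‖ = O(exp (a |re z| + b |im z|))`. -/
def HasExpType (a b : ℝ) (f : ℂ → ℂ) : Prop :=
  Differentiable ℂ f ∧ ∃ C : ℝ, ∀ z, ‖f z‖ ≤ C * Real.exp (a * |z.re| + b * |z.im|)

theorem HasExpType.add {a b : ℝ} {f g : ℂ → ℂ} (hf : HasExpType a b f) (hg : HasExpType a b g) :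
    HasExpType a b (fun z => f z + g z) := by
  obtain ⟨hf, C, hC⟩ := hf
  obtain ⟨hg, D, hD⟩ := hg
  refine ⟨hf.add hg, C + D, fun z => ?_⟩
  rw [add_mul]
  exact (norm_add_le _ _).trans (add_le_add (hC z) (hD z))

theorem HasExpType.const_mul {a b : ℝ} {f : ℂ → ℂ} (c : ℂ) (hf : HasExpType a b f) :
    HasExpType a b (fun z => c * f z) := by
  obtain ⟨hf, C, hC⟩ := hf
  refine ⟨hf.const_mul c, ‖c‖ * C, fun z => ?_⟩
  rw [norm_mul, mul_assoc]
  exact mul_le_mul_of_nonneg_left (hC z) (norm_nonneg c)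

theorem hasExpType_integral {φ ℓ : ℝ → ℂ} {p q a b : ℝ} (hφ : ContinuousOn φ (Set.uIcc p q))
    (hℓ : Continuous ℓ) (ha : ∀ t ∈ Set.uIcc p q, |(ℓ t).re| ≤ a)
    (hb : ∀ t ∈ Set.uIcc p q, |(ℓ t).im| ≤ b) :
    HasExpType a b (fun z => ∫ t in p..q, φ t * Complex.exp (ℓ t * z)) := by
  obtain ⟨M, hM⟩ := isCompact_uIcc.exists_bound_of_continuousOn hφ
  have hM0 : 0 ≤ M := (norm_nonneg _).trans (hM p Set.left_mem_uIcc)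
  have ha0 : 0 ≤ a := (abs_nonneg _).trans (ha p Set.left_mem_uIcc)
  have hb0 : 0 ≤ b := (abs_nonneg _).trans (hb p Set.left_mem_uIcc)
  have hexp (t : ℝ) (ht : t ∈ Set.uIcc p q) (z : ℂ) :
      ‖Complex.exp (ℓ t * z)‖ ≤ Real.exp (a * |z.re| + b * |z.im|) := by
    rw [Complex.norm_exp, Complex.mul_re]
    refine Real.exp_le_exp.2 ((le_abs_self _).trans ((abs_sub _ _).trans ?_))
    rw [abs_mul, abs_mul]
    gcongr
    exacts [ha t ht, hb t ht]
  have hcont (z : ℂ) : ContinuousOn (fun t => φ t * Complex.exp (ℓ t * z)) (Set.uIcc p q) :=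
    hφ.mul (by fun_prop)
  have hcont' (z : ℂ) :
      ContinuousOn (fun t => φ t * (Complex.exp (ℓ t * z) * ℓ t)) (Set.uIcc p q) :=
    hφ.mul (by fun_prop)
  refine ⟨fun z => ?_, M * |q - p|, fun z => ?_⟩
  · refine (intervalIntegral.hasDerivAt_integral_of_dominated_loc_of_deriv_le
      (F' := fun z t => φ t * (Complex.exp (ℓ t * z) * ℓ t))
      (bound := fun _ => M * (Real.exp (a * (‖z‖ + 1) + b * (‖z‖ + 1)) * (a + b)))
      (Metric.ball_mem_nhds z one_pos)
      (Filter.Eventually.of_forall fun w =>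
        (hcont w).intervalIntegrable.aestronglyMeasurable_restrict_uIoc)
      (hcont z).intervalIntegrable (hcont' z).intervalIntegrable.aestronglyMeasurable_restrict_uIoc
      (Filter.Eventually.of_forall fun t ht w hw => ?_) intervalIntegrable_const
      (Filter.Eventually.of_forall fun t ht w hw => ?_)).2.differentiableAt
    · have ht' := Set.uIoc_subset_uIcc ht
      have hw' : ‖w‖ ≤ ‖z‖ + 1 := by
        have := norm_le_norm_add_norm_sub' w z
        rw [Metric.mem_ball, dist_eq_norm] at hw
        linarith
      rw [norm_mul, norm_mul]
      gcongr
      · exact hM t ht'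
      · refine (hexp t ht' w).trans ?_
        gcongr
        · exact (Complex.abs_re_le_norm w).trans hw'
        · exact (Complex.abs_im_le_norm w).trans hw'
      · exact (Complex.norm_le_abs_re_add_abs_im _).trans (add_le_add (ha t ht') (hb t ht'))
    · have := ((hasDerivAt_id w).const_mul (ℓ t)).cexp.const_mul (φ t)
      simpa using this
  · refine (intervalIntegral.norm_integral_le_of_norm_le_const
      (C := M * Real.exp (a * |z.re| + b * |z.im|)) fun t ht => ?_).trans_eq (by ring)
    have ht' := Set.uIoc_subset_uIcc ht
    rw [norm_mul]
    gcongr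
    exacts [hM t ht', hexp t ht' z]

theorem integral_exp_int_mul_I (k : ℤ) (p : ℝ) :
    ∫ t in p..p + 2 * Real.pi, Complex.exp (k * t * Complex.I)
      = if k = 0 then (2 * Real.pi : ℂ) else 0 := by
  split_ifs with hk
  · simp [hk]
  · have hne : (k : ℂ) * Complex.I ≠ 0 := mul_ne_zero (by exact_mod_cast hk) Complex.I_ne_zero
    have h1 := integral_exp_mul_complex (a := p) (b := p + 2 * Real.pi) hne
    have h2 : Complex.exp (k * Complex.I * ((p + 2 * Real.pi : ℝ) : ℂ))
        = Complex.exp (k * Complex.I * p) := by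
      rw [Complex.exp_eq_exp_iff_exists_int]
      exact ⟨k, by push_cast; ring⟩
    rw [h2, sub_self, zero_div] at h1
    rw [← h1]
    congr 1 with t
    ring_nf

/-- Fourier coefficients of an absolutely convergent trigonometric series. -/
theorem integral_tsum_mul_exp {c : ℕ → ℂ} (hc : Summable fun m => ‖c m‖) (k : ℕ → ℤ) (n : ℤ)
    (p : ℝ) :
    ∫ t in p..p + 2 * Real.pi, (∑' m, c m * Complex.exp (k m * t * Complex.I))
        * Complex.exp (-n * t * Complex.I)
      = 2 * Real.pi * ∑' m, if k m = n then c m else 0 := by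
  have hsum (t : ℝ) : (∑' m, c m * Complex.exp (k m * t * Complex.I))
      * Complex.exp (-n * t * Complex.I)
      = ∑' m, c m * Complex.exp ((k m - n : ℤ) * t * Complex.I) := by
    rw [← tsum_mul_right]
    congr 1 with m
    rw [mul_assoc, ← Complex.exp_add]
    push_cast
    ring_nf
  simp_rw [hsum]
  have hnorm (m : ℕ) (t : ℝ) : ‖c m * Complex.exp ((k m - n : ℤ) * t * Complex.I)‖ = ‖c m‖ := by
    rw [norm_mul, show ((k m - n : ℤ) : ℂ) * t = (((k m - n : ℤ) * t : ℝ) : ℂ) by push_cast; ring,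
      Complex.norm_exp_ofReal_mul_I, mul_one]
  have h := intervalIntegral.hasSum_integral_of_dominated_convergence
    (μ := MeasureTheory.volume) (a := p) (b := p + 2 * Real.pi)
    (F := fun m t => c m * Complex.exp ((k m - n : ℤ) * t * Complex.I))
    (f := fun t => ∑' m, c m * Complex.exp ((k m - n : ℤ) * t * Complex.I))
    (fun m _ => ‖c m‖) (fun m => (by fun_prop : Continuous _).aestronglyMeasurable)
    (fun m => Filter.Eventually.of_forall fun t _ => (hnorm m t).le)
    (Filter.Eventually.of_forall fun _ _ => hc) intervalIntegrable_const
    (Filter.Eventually.of_forall fun t _ =>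
      (Summable.of_norm (by simpa only [hnorm] using hc)).hasSum)
  rw [← h.tsum_eq, ← tsum_mul_left]
  congr 1 with m
  rw [intervalIntegral.integral_const_mul, integral_exp_int_mul_I]
  simp only [sub_eq_zero, mul_ite, mul_zero]
  split_ifs <;> ring

theorem exp_notMem_arc {a b : ℝ} {ζ : ℂ}
    (h : ζ.re ≠ 0 ∨ ((b - a) / 2 < |ζ.im - (a + b) / 2| ∧
      |ζ.im - (a + b) / 2| < 2 * Real.pi - (b - a) / 2)) :
    Complex.exp ζ ∈ ((fun θ : ℝ => Complex.exp ((θ : ℂ) * Complex.I)) '' Set.Icc a b)ᶜ := by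
  rintro ⟨θ, ⟨hθ1, hθ2⟩, hθ⟩
  obtain ⟨k, hk⟩ := Complex.exp_eq_exp_iff_exists_int.1 hθ
  have hre : ζ.re = 0 := by simpa using (congrArg Complex.re hk).symm
  have him : θ = ζ.im + k * (2 * Real.pi) := by simpa using congrArg Complex.im hk
  obtain ⟨h1, h2⟩ := h.resolve_left (not_not_intro hre)
  have hpi := Real.pi_pos
  have hd : |ζ.im - (a + b) / 2 + k * (2 * Real.pi)| ≤ (b - a) / 2 :=
    abs_le.2 ⟨by linarith, by linarith⟩
  rcases eq_or_ne k 0 with rfl | hk0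
  · simp only [Int.cast_zero, zero_mul, add_zero] at hd
    linarith
  · have hk1 : (1 : ℝ) ≤ |(k : ℝ)| := by exact_mod_cast Int.one_le_abs hk0
    have h3 : |(k : ℝ) * (2 * Real.pi)| = |(k : ℝ)| * (2 * Real.pi) := by
      rw [abs_mul, abs_of_pos (by positivity : 0 < 2 * Real.pi)]
    have h4 := abs_sub (ζ.im - (a + b) / 2 + k * (2 * Real.pi)) (ζ.im - (a + b) / 2)
    rw [add_sub_cancel_left, h3] at h4
    nlinarith

theorem integral_inner_circle {ξ : ℤ → ℂ} (huni : ∀ n, ‖ξ n‖ = 1) {F : ℂ → ℂ}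
    (hFin : ∀ z : ℂ, ‖z‖ < 1 → F z = ∑' n : ℕ, ξ n * z ^ n) {δ : ℝ} (hδ : 0 < δ)
    (c p : ℝ) (n : ℤ) :
    ∫ t in p..p + 2 * Real.pi, F (Complex.exp (((-δ : ℝ) : ℂ) + t * Complex.I))
        * Complex.exp (-(((-δ : ℝ) : ℂ) + t * Complex.I - c * Complex.I) * n)
      = if 0 ≤ n then 2 * Real.pi * (ξ n * Complex.exp (n * (c * Complex.I))) else 0 := by
  have hc : Summable fun m : ℕ => ‖ξ m * Complex.exp (-δ * m)‖ := by
    have : ∀ m : ℕ, ‖ξ m * Complex.exp (-δ * m)‖ = Real.exp (-δ) ^ m := by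
      intro m
      rw [norm_mul, huni, one_mul, Complex.norm_exp, ← Real.exp_nat_mul]
      simp [mul_comm]
    simp_rw [this]
    exact summable_geometric_of_lt_one (Real.exp_pos _).le (by simpa using hδ)
  have key := integral_tsum_mul_exp hc (fun m => (m : ℤ)) n p
  have hint (t : ℝ) : F (Complex.exp (((-δ : ℝ) : ℂ) + t * Complex.I))
        * Complex.exp (-(((-δ : ℝ) : ℂ) + t * Complex.I - c * Complex.I) * n)
      = Complex.exp (n * δ + n * (c * Complex.I)) *
        ((∑' m : ℕ, ξ m * Complex.exp (-δ * m) * Complex.exp ((m : ℤ) * t * Complex.I))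
        * Complex.exp (-n * t * Complex.I)) := by
    rw [hFin _ (by rw [Complex.norm_exp]; simpa using hδ), mul_left_comm, ← Complex.exp_add]
    congr 1
    · congr 1 with m
      rw [← Complex.exp_nat_mul, mul_assoc, ← Complex.exp_add]
      push_cast
      ring_nf
    · push_cast
      ring_nf
  simp_rw [hint]
  rw [intervalIntegral.integral_const_mul, key]
  split_ifs with hn
  · lift n to ℕ using hn
    rw [tsum_eq_single n (fun m hm => if_neg (by exact_mod_cast hm)), if_pos rfl, Complex.exp_add]
    have : Complex.exp ((n : ℤ) * δ) * Complex.exp (-δ * n) = 1 := by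
      rw [← Complex.exp_add, Int.cast_natCast]
      ring_nf
      simp
    linear_combination (2 * Real.pi * ξ n * Complex.exp ((n : ℤ) * (c * Complex.I))) * this
  · have : ∀ m : ℕ, ¬ ((m : ℤ) = n) := by lia
    simp [this]

theorem integral_outer_circle {ξ : ℤ → ℂ} (huni : ∀ n, ‖ξ n‖ = 1) {F : ℂ → ℂ}
    (hFout : ∀ z : ℂ, 1 < ‖z‖ →
      F z = -∑' n : ℕ, ξ (-(n + 1 : ℕ)) * z ^ (-(n + 1 : ℕ) : ℤ)) {δ : ℝ} (hδ : 0 < δ)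
    (c p : ℝ) (n : ℤ) :
    ∫ t in p..p + 2 * Real.pi, F (Complex.exp ((δ : ℂ) + t * Complex.I))
        * Complex.exp (-((δ : ℂ) + t * Complex.I - c * Complex.I) * n)
      = if 0 ≤ n then 0 else -(2 * Real.pi * (ξ n * Complex.exp (n * (c * Complex.I)))) := by
  have hc : Summable fun m : ℕ => ‖ξ (-(m + 1 : ℕ)) * Complex.exp (-δ * (m + 1 : ℕ))‖ := by
    have : ∀ m : ℕ, ‖ξ (-(m + 1 : ℕ)) * Complex.exp (-δ * (m + 1 : ℕ))‖
        = Real.exp (-δ) ^ (m + 1) := by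
      intro m
      rw [norm_mul, huni, one_mul, Complex.norm_exp, ← Real.exp_nat_mul, mul_comm]
      congr 1
      rw [← Complex.ofReal_natCast, ← Complex.ofReal_neg, ← Complex.ofReal_mul, Complex.ofReal_re]
    simp_rw [this]
    exact (summable_nat_add_iff 1).2
      (summable_geometric_of_lt_one (Real.exp_pos _).le (by simpa using hδ))
  have key := integral_tsum_mul_exp hc (fun m => (-(m + 1 : ℕ) : ℤ)) n p
  have hint (t : ℝ) : F (Complex.exp ((δ : ℂ) + t * Complex.I))
        * Complex.exp (-((δ : ℂ) + t * Complex.I - c * Complex.I) * n)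
      = -Complex.exp (-n * δ + n * (c * Complex.I)) *
        ((∑' m : ℕ, ξ (-(m + 1 : ℕ)) * Complex.exp (-δ * (m + 1 : ℕ))
            * Complex.exp ((-(m + 1 : ℕ) : ℤ) * t * Complex.I))
        * Complex.exp (-n * t * Complex.I)) := by
    rw [hFout _ (by rw [Complex.norm_exp]; simpa using hδ), neg_mul,
      neg_mul (Complex.exp (-n * δ + n * (c * Complex.I))), mul_left_comm, ← Complex.exp_add]
    congr 2
    · congr 1 with m
      rw [← Complex.exp_int_mul, mul_assoc, ← Complex.exp_add]
      push_cast
      ring_nf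
    · ring_nf
  simp_rw [hint]
  rw [intervalIntegral.integral_const_mul, key]
  split_ifs with hn
  · have : ∀ m : ℕ, ¬ (-((m + 1 : ℕ) : ℤ) = n) := by lia
    simp only [this, if_false, tsum_zero, mul_zero]
  · obtain ⟨m, rfl⟩ : ∃ m : ℕ, n = -((m + 1 : ℕ) : ℤ) := ⟨(-n - 1).toNat, by lia⟩
    rw [tsum_eq_single m (fun k hk => if_neg (by lia)), if_pos rfl, Complex.exp_add]
    have : Complex.exp (-((-((m + 1 : ℕ) : ℤ) : ℤ) : ℂ) * δ) * Complex.exp (-δ * (m + 1 : ℕ))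
        = 1 := by
      rw [← Complex.exp_add]
      push_cast
      ring_nf
      simp
    linear_combination (-(2 * Real.pi * ξ (-((m + 1 : ℕ) : ℤ))
      * Complex.exp ((-((m + 1 : ℕ) : ℤ) : ℤ) * (c * Complex.I)))) * this

/-- A sequence whose Fourier–Carleman transform is analytic off an arc is interpolated, up to a
rotation centring the arc, by an entire function of exponential type governed by the arc. -/
theorem exists_hasExpType_interpolating {ξ : ℤ → ℂ} (huni : ∀ n, ‖ξ n‖ = 1) {a b δ : ℝ}
    (hab : a ≤ b) (hδ : 0 < δ) (hπ : (b - a) / 2 + δ < Real.pi) {F : ℂ → ℂ}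
    (hF : AnalyticOnNhd ℂ F
      ((fun θ : ℝ => Complex.exp ((θ : ℂ) * Complex.I)) '' Set.Icc a b)ᶜ)
    (hFin : ∀ z : ℂ, ‖z‖ < 1 → F z = ∑' n : ℕ, ξ n * z ^ n)
    (hFout : ∀ z : ℂ, 1 < ‖z‖ →
      F z = -∑' n : ℕ, ξ (-(n + 1 : ℕ)) * z ^ (-(n + 1 : ℕ) : ℤ)) :
    ∃ f : ℂ → ℂ, HasExpType δ ((b - a) / 2 + δ) f ∧
      ∀ n : ℤ, f n = ξ n * Complex.exp (n * (((a + b) / 2 : ℝ) * Complex.I)) := by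
  set c : ℝ := (a + b) / 2 with hc
  set σ : ℝ := (b - a) / 2 + δ with hσ
  have hσ0 : 0 < σ := by linarith
  have hdiff (ζ : ℂ) (h : ζ.re ≠ 0 ∨ (σ ≤ |ζ.im - c| ∧ |ζ.im - c| ≤ 2 * Real.pi - σ)) :
      DifferentiableAt ℂ (fun ζ => F (Complex.exp ζ)) ζ :=
    (hF _ (exp_notMem_arc (h.imp_right fun h =>
      ⟨by linarith [h.1], by linarith [h.2]⟩))).differentiableAt.comp ζ
        Complex.differentiable_exp.differentiableAt
  have hA (u : ℝ) (hu : |u| = δ) (p q : ℝ) :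
      ContinuousOn (fun t : ℝ => F (Complex.exp ((u : ℂ) + t * Complex.I))) (Set.uIcc p q) := by
    intro t _
    have h1 := (hdiff ((u : ℂ) + t * Complex.I) (Or.inl (by
      simp only [Complex.add_re, Complex.ofReal_re, Complex.mul_re, Complex.I_re, mul_zero,
        Complex.ofReal_im, Complex.I_im, mul_one, sub_self, add_zero]
      rintro rfl
      simp at hu
      linarith))).continuousAt
    exact (ContinuousAt.comp (f := fun t : ℝ => (u : ℂ) + t * Complex.I) h1
      (by fun_prop)).continuousWithinAt
  have hB (v : ℝ) (hv : |v - c| = σ) :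
      ContinuousOn (fun x : ℝ => F (Complex.exp ((x : ℂ) + v * Complex.I)))
        (Set.uIcc (-δ) δ) := by
    intro x _
    have h1 := (hdiff ((x : ℂ) + v * Complex.I) (Or.inr (by
      simp only [Complex.add_im, Complex.ofReal_im, Complex.mul_im, Complex.I_re, mul_zero,
        Complex.ofReal_re, Complex.I_im, mul_one, zero_add, add_zero, hv]
      exact ⟨le_rfl, by linarith⟩))).continuousAt
    exact (ContinuousAt.comp (f := fun x : ℝ => (x : ℂ) + v * Complex.I) h1
      (by fun_prop)).continuousWithinAt
  have hAtype (u : ℝ) (hu : |u| = δ) : HasExpType δ σ (fun z => ∫ t in c - σ..c + σ,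
      F (Complex.exp ((u : ℂ) + t * Complex.I))
        * Complex.exp (-((u : ℂ) + t * Complex.I - c * Complex.I) * z)) := by
    refine hasExpType_integral (hA u hu _ _) (by fun_prop) (fun t _ => ?_) (fun t ht => ?_)
    · simp [hu]
    · rw [Set.uIcc_of_le (by linarith)] at ht
      simp only [Complex.neg_im, Complex.sub_im, Complex.add_im, Complex.ofReal_im,
        Complex.mul_im, Complex.I_re, mul_zero, Complex.ofReal_re, Complex.I_im, mul_one,
        zero_add, add_zero, abs_neg]
      exact abs_le.2 ⟨by linarith [ht.1], by linarith [ht.2]⟩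
  have hBtype (v : ℝ) (hv : |v - c| = σ) : HasExpType δ σ (fun z => ∫ x in -δ..δ,
      F (Complex.exp ((x : ℂ) + v * Complex.I))
        * Complex.exp (-((x : ℂ) + v * Complex.I - c * Complex.I) * z)) := by
    refine hasExpType_integral (hB v hv) (by fun_prop) (fun t ht => ?_) (fun t _ => ?_)
    · rw [Set.uIcc_of_le (by linarith)] at ht
      simp only [Complex.neg_re, Complex.sub_re, Complex.add_re, Complex.ofReal_im,
        Complex.mul_re, Complex.I_re, mul_zero, Complex.ofReal_re, Complex.I_im, mul_one,
        sub_self, sub_zero, add_zero, abs_neg]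
      exact abs_le.2 ht
    · simp only [Complex.neg_im, Complex.sub_im, Complex.add_im, Complex.ofReal_im,
        Complex.mul_im, Complex.I_re, mul_zero, Complex.ofReal_re, Complex.I_im, mul_one,
        zero_add, add_zero, abs_neg, hv, le_refl]
  have hδ1 : |-δ| = δ := by rw [abs_neg, abs_of_pos hδ]
  have hδ2 : |δ| = δ := abs_of_pos hδ
  have hσ1 : |c - σ - c| = σ := by rw [sub_sub_cancel_left, abs_neg, abs_of_pos hσ0]
  have hσ2 : |c + σ - c| = σ := by rw [add_sub_cancel_left, abs_of_pos hσ0]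
  refine ⟨_, HasExpType.const_mul (2 * Real.pi : ℂ)⁻¹
    (((hAtype (-δ) hδ1).add ((hAtype δ hδ2).const_mul (-1))).add
      (((hBtype (c - σ) hσ1).add ((hBtype (c + σ) hσ2).const_mul (-1))).const_mul Complex.I)),
    fun n => ?_⟩
  set G : ℂ → ℂ := fun ζ => F (Complex.exp ζ) * Complex.exp (-(ζ - c * Complex.I) * n) with hG
  have hper (ζ : ℂ) : G (ζ + 2 * Real.pi * Complex.I) = G ζ := by
    have h1 : Complex.exp (ζ + 2 * Real.pi * Complex.I) = Complex.exp ζ :=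
      Complex.exp_periodic ζ
    have h2 : Complex.exp (-(ζ + 2 * Real.pi * Complex.I - c * Complex.I) * n)
        = Complex.exp (-(ζ - c * Complex.I) * n) := by
      rw [Complex.exp_eq_exp_iff_exists_int]
      exact ⟨-n, by push_cast; ring⟩
    simp only [hG, h1, h2]
  have hGd (ζ : ℂ) (h : σ ≤ |ζ.im - c| ∧ |ζ.im - c| ≤ 2 * Real.pi - σ) :
      DifferentiableAt ℂ G ζ := (hdiff ζ (Or.inr h)).mul (by fun_prop)
  have hrect := Complex.integral_boundary_rect_eq_zero_of_differentiableOn G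
    (⟨-δ, c + σ⟩ : ℂ) (⟨δ, c - σ + 2 * Real.pi⟩ : ℂ) (fun ζ hζ => by
      rw [Complex.mem_reProdIm, Set.uIcc_of_le (by linarith), Set.uIcc_of_le (by linarith)] at hζ
      have h1 := hζ.2.1
      have h2 := hζ.2.2
      dsimp only at h1 h2
      refine (hGd ζ ?_).differentiableWithinAt
      rw [abs_of_nonneg (by linarith)]
      exact ⟨by linarith, by linarith⟩)
  have hin := integral_inner_circle huni hFin hδ c (c - σ) n
  have hout := integral_outer_circle huni hFout hδ c (c - σ) n
  have hGint (u : ℝ) (hu : |u| = δ) (p q : ℝ) :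
      IntervalIntegrable (fun t : ℝ => G ((u : ℂ) + t * Complex.I)) MeasureTheory.volume p q :=
    ((hA u hu p q).mul (by fun_prop)).intervalIntegrable
  have hadd (u : ℝ) (hu : |u| = δ) :=
    intervalIntegral.integral_add_adjacent_intervals (hGint u hu (c - σ) (c + σ))
      (hGint u hu (c + σ) (c - σ + 2 * Real.pi))
  have hadd1 := hadd (-δ) hδ1
  have hadd2 := hadd δ hδ2
  have hperB : ∫ x in -δ..δ, G ((x : ℂ) + ((c - σ + 2 * Real.pi : ℝ) : ℂ) * Complex.I)
      = ∫ x in -δ..δ, G ((x : ℂ) + ((c - σ : ℝ) : ℂ) * Complex.I) := by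
    congr 1 with x
    rw [← hper ((x : ℂ) + ((c - σ : ℝ) : ℂ) * Complex.I)]
    congr 1
    push_cast
    ring
  simp only [smul_eq_mul] at hrect
  rw [hperB] at hrect
  have hdif : (∫ t in c - σ..c - σ + 2 * Real.pi, G (((-δ : ℝ) : ℂ) + t * Complex.I))
      - (∫ t in c - σ..c - σ + 2 * Real.pi, G ((δ : ℂ) + t * Complex.I))
      = 2 * Real.pi * (ξ n * Complex.exp (n * (c * Complex.I))) := by
    simp only [hG]
    rw [hin, hout]
    split_ifs <;> simp
  have hpi : (2 * Real.pi : ℂ) ≠ 0 := by simp [Real.pi_ne_zero]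
  rw [inv_mul_eq_iff_eq_mul₀ hpi, ← hdif, ← hadd1, ← hadd2]
  linear_combination (-Complex.I) * hrect
    + ((∫ t in c + σ..c - σ + 2 * Real.pi, G ((δ : ℂ) + t * Complex.I))
      - ∫ t in c + σ..c - σ + 2 * Real.pi, G (((-δ : ℝ) : ℂ) + t * Complex.I)) * Complex.I_sq

/-- Let `ξ : ℤ → 𝕋` be unimodular and suppose its
Fourier–Carleman transform extends analytically across the complement of an
arc `J = {exp(iθ) : θ ∈ [a,b]}` of length `b - a < π`: there is `F : ℂ → ℂ`
analytic on `ℂ ∖ J` (and vanishing at `∞`) with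
`F(z) = Σ_{n≥0} ξ(n) zⁿ` for `|z| < 1` and
`F(z) = -Σ_{n≤-1} ξ(n) zⁿ` for `|z| > 1`.
Then `ξ(n) = t sⁿ` for some unimodular `t, s`. -/
theorem stmt16 (ξ : ℤ → ℂ) (huni : ∀ n, ‖ξ n‖ = 1)
    (a b : ℝ) (hab : a ≤ b) (hlen : b - a < Real.pi)
    (F : ℂ → ℂ)
    (hF : AnalyticOnNhd ℂ F
      ((fun θ : ℝ => Complex.exp ((θ : ℂ) * Complex.I)) '' Set.Icc a b)ᶜ)
    (hFin : ∀ z : ℂ, ‖z‖ < 1 → F z = ∑' n : ℕ, ξ n * z ^ n)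
    (hFout : ∀ z : ℂ, 1 < ‖z‖ → F z = -∑' n : ℕ, ξ (-(n + 1 : ℕ)) * z ^ (-(n + 1 : ℕ) : ℤ))
    (hFinfty : Filter.Tendsto F (Bornology.cobounded ℂ) (nhds 0)) :
    ∃ t s : ℂ, ‖t‖ = 1 ∧ ‖s‖ = 1 ∧ ∀ n : ℤ, ξ n = t * s ^ n := by
  have hδ : 0 < (Real.pi - (b - a)) / 8 := by linarith
  obtain ⟨f, ⟨hfd, C, hC⟩, hfξ⟩ :=
    exists_hasExpType_interpolating huni hab hδ (by linarith) hF hFin hFout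
  obtain ⟨α, β, hαβ⟩ := Complex.eq_exp_of_forall_int_norm_eq_one hfd hδ.le (by linarith)
    (by linarith) hC (fun n => by
      rw [hfξ n, norm_mul, huni, one_mul, Complex.norm_exp]
      simp)
  set γ : ℂ := (((a + b) / 2 : ℝ) : ℂ) * Complex.I with hγ
  have hform (n : ℤ) : ξ n = Complex.exp β * Complex.exp (α - γ) ^ n := by
    rw [← Complex.exp_int_mul, ← Complex.exp_add]
    have h1 := (hfξ n).symm.trans (hαβ n)
    rw [show β + n * (α - γ) = (α * n + β) - n * γ by ring, Complex.exp_sub, ← h1,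
      mul_div_cancel_right₀ _ (Complex.exp_ne_zero _)]
  have ht : ‖Complex.exp β‖ = 1 := by simpa [hform] using huni 0
  refine ⟨_, _, ht, ?_, hform⟩
  have := huni 1
  rwa [hform, zpow_one, norm_mul, ht, one_mul] at this
end
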